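/- Let q be a prime power, m ≥ 1, and n = 2m−1. For each point P of F_q^{2m} and each j ∈ {1,…,m}, the function χ_j^P is an eigenfunction of the adjacency operator of the opposition graph on maximal flags of F_q^{2m} with eigenvalue −q^{2m²−2m} = −q^{(n²−1)/2}, and the set of functions {χ_j^P : j ∈ {1,…,m}, P a point of F_q^{2m}} spans the full eigenspace of this eigenvalue. -/

import Mathlib

open Matrix

/-- A maximal flag in `F^(2m)`: a chain `U 0 ⊆ ⋯ ⊆ U (2m)` with `dim (U k) = k`. -/
def MaxFlag2 (F : Type) [Field F] (m : ℕ) : Type :=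
  {U : Fin (2 * m + 1) → Submodule F (Fin (2 * m) → F) //
    Monotone U ∧ ∀ k : Fin (2 * m + 1), Module.finrank F (U k) = (k : ℕ)}

instance (F : Type) [Field F] [Fintype F] (m : ℕ) : Finite (MaxFlag2 F m) :=
  Subtype.finite

noncomputable instance (F : Type) [Field F] [Fintype F] (m : ℕ) : Fintype (MaxFlag2 F m) :=
  Fintype.ofFinite _

noncomputable def flagMem2 {F : Type} [Field F] {m : ℕ} (c : MaxFlag2 F m) (k : ℕ) :
    Submodule F (Fin (2 * m) → F) :=
  if h : k < 2 * m + 1 then c.1 ⟨k, h⟩ else ⊤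

/-- Two maximal flags of `F^(2m)` are opposite when `U_i ∩ V_(2m-i) = 0` for all `i`. -/
def Opp2 {F : Type} [Field F] {m : ℕ} (c d : MaxFlag2 F m) : Prop :=
  ∀ i : Fin (2 * m + 1), c.1 i ⊓ d.1 i.rev = ⊥

open Classical in
/-- The adjacency matrix (over `ℂ`) of the opposition graph on maximal flags of `F^(2m)`;
its `mulVecLin` is the adjacency operator on complex-valued functions. -/
noncomputable def adj2 (F : Type) [Field F] [Fintype F] (m : ℕ) :
    Matrix (MaxFlag2 F m) (MaxFlag2 F m) ℂ :=
  fun c d => if Opp2 c d then 1 else 0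

open Classical in
/-- The function `χ_j^P`: value `0` if `P ⊆ U_(m-j)`, `q^j` if `P ⊆ U_m`, `P ⊄ U_(m-j)`,
`-1` if `P ⊆ U_(m+j)`, `P ⊄ U_m`, and `0` if `P ⊄ U_(m+j)`. -/
noncomputable def chi2 (F : Type) [Field F] [Fintype F] (m : ℕ) (j : ℕ)
    (P : Submodule F (Fin (2 * m) → F)) (c : MaxFlag2 F m) : ℂ :=
  if P ≤ flagMem2 c (m - j) then 0
  else if P ≤ flagMem2 c m then (Fintype.card F : ℂ) ^ j
  else if P ≤ flagMem2 c (m + j) then -1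
  else 0

/-- The relations of the type `A` Iwahori-Hecke algebra with parameter `q`, generated by
`T 0, …, T (r - 1)`. -/
structure HeckeRel {R : Type*} [Ring R] [Algebra ℂ R] (q : ℕ) (r : ℕ) (T : ℕ → R) : Prop where
  quad : ∀ i < r, T i * T i = ((q : ℂ) - 1) • T i + (q : ℂ) • (1 : R)
  braid : ∀ i, i + 1 < r → T i * T (i + 1) * T i = T (i + 1) * T i * T (i + 1)
  comm : ∀ i j, i + 1 < j → j < r → Commute (T i) (T j)

/-- The multiplicative Jucys-Murphy elements. -/
def jucysMurphy {R : Type*} [Monoid R] (T : ℕ → R) : ℕ → R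
  | 0 => 1
  | k + 1 => T k * jucysMurphy T k * T k

/-- The product of the first `k` nontrivial Jucys-Murphy elements. -/
def jucysMurphyProd {R : Type*} [Monoid R] (T : ℕ → R) : ℕ → R
  | 0 => 1
  | k + 1 => jucysMurphy T (k + 1) * jucysMurphyProd T k

/-- The product `T (k - 1) ⋯ T 0`. -/
def coxeterProd {R : Type*} [Monoid R] (T : ℕ → R) : ℕ → R
  | 0 => 1
  | k + 1 => T k * coxeterProd T k

/-- The element of the longest word in `T 0, …, T (k - 2)`. -/
def longestProd {R : Type*} [Monoid R] (T : ℕ → R) : ℕ → R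
  | 0 => 1
  | k + 1 => longestProd T k * coxeterProd T k

namespace HeckeRel

section Ring

variable {R : Type*} [Ring R] [Algebra ℂ R] {q r : ℕ} {T : ℕ → R}

theorem commute_jucysMurphy_of_lt (h : HeckeRel q r T) {k i : ℕ} (hk : k < i) (hi : i < r) :
    Commute (T i) (jucysMurphy T k) := by
  induction k with
  | zero => exact Commute.one_right _
  | succ k ih =>
    have h1 := (h.comm k i hk hi).symm
    exact (h1.mul_right (ih (by omega))).mul_right h1

theorem commute_jucysMurphy (h : HeckeRel q r T) {k i : ℕ} (hk : k ≤ r) (hi : i < r)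
    (h1 : i ≠ k) (h2 : i + 1 ≠ k) : Commute (T i) (jucysMurphy T k) := by
  induction k with
  | zero => exact Commute.one_right _
  | succ k ih =>
    rcases lt_trichotomy (i + 1) k with hlt | heq | hgt
    · have h3 := h.comm i k hlt (by omega)
      exact (h3.mul_right (ih (by omega) (by omega) (by omega))).mul_right h3
    · subst heq
      have hb := h.braid i (by omega)
      have hc : T (i + 1) * jucysMurphy T i = jucysMurphy T i * T (i + 1) :=
        h.commute_jucysMurphy_of_lt (Nat.lt_succ_self i) (by omega)
      change T i * (T (i + 1) * (T i * jucysMurphy T i * T i) * T (i + 1)) =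
        T (i + 1) * (T i * jucysMurphy T i * T i) * T (i + 1) * T i
      calc _ = (T i * T (i + 1) * T i) * jucysMurphy T i * T i * T (i + 1) := by
            simp only [mul_assoc]
        _ = T (i + 1) * T i * (T (i + 1) * jucysMurphy T i) * T i * T (i + 1) := by
            rw [hb]; simp only [mul_assoc]
        _ = T (i + 1) * T i * jucysMurphy T i * (T (i + 1) * T i * T (i + 1)) := by
            rw [hc]; simp only [mul_assoc]
        _ = _ := by rw [← hb]; simp only [mul_assoc]
    · exact h.commute_jucysMurphy_of_lt (by omega) hi

theorem commute_jucysMurphy_jucysMurphy (h : HeckeRel q r T) {j k : ℕ} (hjk : j ≤ k)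
    (hk : k ≤ r) : Commute (jucysMurphy T j) (jucysMurphy T k) := by
  induction j with
  | zero => exact Commute.one_left _
  | succ j ih =>
    rcases hjk.eq_or_lt with rfl | hlt
    · exact Commute.refl _
    · have h1 := h.commute_jucysMurphy hk (i := j) (by omega) (by omega) (by omega)
      exact (h1.mul_left (ih (by omega))).mul_left h1

theorem commute_jucysMurphyProd_of_lt (h : HeckeRel q r T) {k i : ℕ} (hk : k < i) (hi : i < r) :
    Commute (T i) (jucysMurphyProd T k) := by
  induction k with
  | zero => exact Commute.one_right _
  | succ k ih => exact (h.commute_jucysMurphy_of_lt hk hi).mul_right (ih (by omega))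

theorem commute_jucysMurphyProd (h : HeckeRel q r T) {k i : ℕ} (hk : k ≤ r) (hi : i < k) :
    Commute (T i) (jucysMurphyProd T k) := by
  induction k with
  | zero => omega
  | succ k ih =>
    rcases Nat.lt_succ_iff_lt_or_eq.mp hi with hlt | rfl
    · exact (h.commute_jucysMurphy hk (by omega) (by omega) (by omega)).mul_right
        (ih (by omega) hlt)
    · have hc : jucysMurphy T i * jucysMurphy T (i + 1) =
          jucysMurphy T (i + 1) * jucysMurphy T i :=
        h.commute_jucysMurphy_jucysMurphy (Nat.le_succ i) hk
      have key : Commute (T i) (jucysMurphy T (i + 1) * jucysMurphy T i) := by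
        change T i * (jucysMurphy T (i + 1) * jucysMurphy T i) =
          jucysMurphy T (i + 1) * jucysMurphy T i * T i
        rw [← hc]
        conv_rhs => rw [hc]
        simp only [jucysMurphy, mul_assoc]
      cases i with
      | zero => simp [jucysMurphyProd, jucysMurphy]
      | succ i =>
        have h2 := h.commute_jucysMurphyProd_of_lt (Nat.lt_succ_self i) (by omega)
        have h3 := key.mul_right h2
        rwa [mul_assoc] at h3

theorem _root_.commute_longestProd {R : Type*} [Ring R] {T : ℕ → R} {x : R} {k : ℕ}
    (hx : ∀ i, i + 1 < k → Commute (T i) x) : Commute (longestProd T k) x := by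
  have hc : ∀ j, j < k → Commute (coxeterProd T j) x := by
    intro j hj
    induction j with
    | zero => exact Commute.one_left _
    | succ j ih => exact (hx j hj).mul_left (ih (by omega))
  have : ∀ j ≤ k, Commute (longestProd T j) x := by
    intro j hj
    induction j with
    | zero => exact Commute.one_left _
    | succ j ih => exact (ih (by omega)).mul_left (hc j hj)
  exact this k le_rfl

end Ring

section Matrix

variable {X : Type*} [Fintype X] [DecidableEq X] {q r : ℕ} {T : ℕ → Matrix X X ℂ}

theorem coxeterProd_mul_transpose (hT : ∀ i < r, (T i)ᵀ = T i) {k : ℕ} (hk : k ≤ r) :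
    coxeterProd T k * (coxeterProd T k)ᵀ = jucysMurphy T k := by
  induction k with
  | zero => simp [coxeterProd, jucysMurphy]
  | succ k ih =>
    simp only [coxeterProd, jucysMurphy, Matrix.transpose_mul, hT k hk]
    rw [← ih (by omega)]
    simp only [mul_assoc]

theorem longestProd_sq (h : HeckeRel q r T) (hT : ∀ i < r, (T i)ᵀ = T i) {k : ℕ} (hk : k ≤ r)
    (hA : ∀ k ≤ r + 1, (longestProd T k)ᵀ = longestProd T k) :
    longestProd T (k + 1) * longestProd T (k + 1) = jucysMurphyProd T k := by
  induction k with
  | zero => simp [longestProd, coxeterProd, jucysMurphyProd]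
  | succ k ih =>
    have h1 : longestProd T (k + 1 + 1) =
        (coxeterProd T (k + 1))ᵀ * longestProd T (k + 1) := by
      rw [← hA (k + 1 + 1) (by omega), longestProd, Matrix.transpose_mul, hA (k + 1) (by omega)]
    have h2 : Commute (longestProd T (k + 1)) (jucysMurphy T (k + 1)) :=
      commute_longestProd fun i hi =>
        h.commute_jucysMurphy hk (by omega) (by omega) (by omega)
    calc longestProd T (k + 1 + 1) * longestProd T (k + 1 + 1)
        = (longestProd T (k + 1) * coxeterProd T (k + 1)) *
          ((coxeterProd T (k + 1))ᵀ * longestProd T (k + 1)) := by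
          conv_lhs => enter [2]; rw [h1]
          rfl
      _ = longestProd T (k + 1) * (coxeterProd T (k + 1) * (coxeterProd T (k + 1))ᵀ) *
          longestProd T (k + 1) := by simp only [mul_assoc]
      _ = jucysMurphy T (k + 1) * (longestProd T (k + 1) * longestProd T (k + 1)) := by
          rw [coxeterProd_mul_transpose hT hk, h2.eq, mul_assoc]
      _ = _ := by rw [ih (by omega)]; rfl

end Matrix

end HeckeRel

section Spectral

open Module.End

variable {V : Type*} [NormedAddCommGroup V] [InnerProductSpace ℂ V]

/-- `v` is fixed up to the trivial character by `T 0, …, T (k - 1)`. -/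
def IsTrivVec (q : ℕ) (T : ℕ → Module.End ℂ V) (k : ℕ) (v : V) : Prop :=
  ∀ i < k, T i v = (q : ℂ) • v

/-- `v` is a joint eigenvector of the first `k` Jucys-Murphy elements with eigenvalues `a`. -/
def IsWeightVec (T : ℕ → Module.End ℂ V) (k : ℕ) (a : ℕ → ℂ) (v : V) : Prop :=
  v ≠ 0 ∧ ∀ j ≤ k, jucysMurphy T j v = a j • v

theorem IsTrivVec.mono {q : ℕ} {T : ℕ → Module.End ℂ V} {j k : ℕ} {v : V}
    (h : IsTrivVec q T k v) (hjk : j ≤ k) : IsTrivVec q T j v :=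
  fun i hi => h i (hi.trans_le hjk)

theorem IsTrivVec.succ {q : ℕ} {T : ℕ → Module.End ℂ V} {k : ℕ} {v : V}
    (h : IsTrivVec q T k v) (hk : T k v = (q : ℂ) • v) : IsTrivVec q T (k + 1) v := by
  intro i hi
  rcases Nat.lt_succ_iff_lt_or_eq.mp hi with hlt | rfl
  · exact h i hlt
  · exact hk

theorem IsWeightVec.mono {T : ℕ → Module.End ℂ V} {j k : ℕ} {a : ℕ → ℂ} {v : V}
    (h : IsWeightVec T k a v) (hjk : j ≤ k) : IsWeightVec T j a v :=
  ⟨h.1, fun i hi => h.2 i (hi.trans hjk)⟩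

theorem isSymmetric_jucysMurphy {T : ℕ → Module.End ℂ V} {r : ℕ}
    (hs : ∀ i < r, (T i).IsSymmetric) {k : ℕ} (hk : k ≤ r) :
    (jucysMurphy T k).IsSymmetric := by
  induction k with
  | zero => intro x y; rfl
  | succ k ih =>
    intro x y
    simp only [jucysMurphy, Module.End.mul_apply]
    rw [hs k hk, ih (by omega), hs k hk]

namespace HeckeRel

variable {q r : ℕ} {T : ℕ → Module.End ℂ V}

theorem quad_apply (h : HeckeRel q r T) {i : ℕ} (hi : i < r) (v : V) :
    T i (T i v) = ((q : ℂ) - 1) • T i v + (q : ℂ) • v := by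
  have := congrArg (fun f => f v) (h.quad i hi)
  simpa using this

theorem braid_apply (h : HeckeRel q r T) {i : ℕ} (hi : i + 1 < r) (v : V) :
    T i (T (i + 1) (T i v)) = T (i + 1) (T i (T (i + 1) v)) := by
  have := congrArg (fun f => f v) (h.braid i hi)
  simpa using this

theorem comm_apply (h : HeckeRel q r T) {i j : ℕ} (hij : i + 1 < j) (hj : j < r) (v : V) :
    T i (T j v) = T j (T i v) := by
  have := congrArg (fun f => f v) (h.comm i j hij hj).eq
  simpa using this

theorem apply_ne_zero (h : HeckeRel q r T) (hq : 2 ≤ q) {i : ℕ} (hi : i < r) {v : V}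
    (hv : v ≠ 0) : T i v ≠ 0 := by
  intro h0
  have h1 := h.quad_apply hi v
  rw [h0] at h1
  have hq0 : (q : ℂ) ≠ 0 := by exact_mod_cast (by omega : q ≠ 0)
  rw [map_zero, smul_zero, zero_add] at h1
  exact smul_ne_zero hq0 hv h1.symm

theorem jucysMurphy_apply_ne_zero (h : HeckeRel q r T) (hq : 2 ≤ q) {k : ℕ} (hk : k ≤ r)
    {v : V} (hv : v ≠ 0) : jucysMurphy T k v ≠ 0 := by
  induction k generalizing v with
  | zero => exact hv
  | succ k ih =>
    exact h.apply_ne_zero hq hk (ih (by omega) (h.apply_ne_zero hq hk hv))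

theorem weight_ne_zero (h : HeckeRel q r T) (hq : 2 ≤ q) {k : ℕ} (hk : k ≤ r) {a : ℕ → ℂ}
    {v : V} (hv : IsWeightVec T k a v) : a k ≠ 0 := by
  intro h0
  have h1 := hv.2 k le_rfl
  rw [h0, zero_smul] at h1
  exact h.jucysMurphy_apply_ne_zero hq hk hv.1 h1

/-- Exchange of adjacent Jucys-Murphy weights. -/
theorem weight_succ_cases [FiniteDimensional ℂ V] (h : HeckeRel q r T) (hq : 2 ≤ q)
    (hs : ∀ i < r, (T i).IsSymmetric) {k : ℕ} (hk : k < r) {a : ℕ → ℂ} {v : V}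
    (hv : IsWeightVec T (k + 1) a v) :
    (T k v = (q : ℂ) • v ∧ a (k + 1) = (q : ℂ) ^ 2 * a k) ∨
    (T k v = -v ∧ a (k + 1) = a k) ∨
    ∃ (a' : ℕ → ℂ) (c : ℂ), a (k + 1) = q * a' k ∧ a' k ≠ a k ∧
      IsWeightVec T k a' (T k v + c • v) := by
  have hq0 : (q : ℂ) ≠ 0 := by exact_mod_cast (by omega : q ≠ 0)
  have hq1 : (q : ℂ) - 1 ≠ 0 := sub_ne_zero.mpr (by exact_mod_cast (by omega : q ≠ 1))
  have hL1 : T k (jucysMurphy T k (T k v)) = a (k + 1) • v := hv.2 (k + 1) le_rfl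
  have hL0 : jucysMurphy T k v = a k • v := hv.2 k (Nat.le_succ k)
  have ha0 : a k ≠ 0 := h.weight_ne_zero hq hk.le (hv.mono (Nat.le_succ k))
  by_cases hprop : ∃ l : ℂ, T k v = l • v
  · obtain ⟨l, hl⟩ := hprop
    have h1 := h.quad_apply hk v
    rw [hl, map_smul, hl, smul_smul, smul_smul, ← add_smul] at h1
    have h2 := smul_left_injective ℂ hv.1 h1
    have h3 : (l - q) * (l + 1) = 0 := by linear_combination h2
    rw [hl, map_smul, hL0, smul_smul, map_smul, hl, smul_smul] at hL1
    have h4 : l * a k * l = a (k + 1) := smul_left_injective ℂ hv.1 hL1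
    rcases mul_eq_zero.mp h3 with h5 | h5
    · obtain rfl : l = q := sub_eq_zero.mp h5
      exact Or.inl ⟨hl, by rw [← h4]; ring⟩
    · obtain rfl : l = -1 := eq_neg_of_add_eq_zero_left h5
      exact Or.inr (Or.inl ⟨by rw [hl, neg_one_smul], by rw [← h4]; ring⟩)
  · right; right
    push Not at hprop
    set b : ℂ := a (k + 1) / q with hb
    have hbq : a (k + 1) = q * b := by rw [hb]; field_simp
    have hLT : jucysMurphy T k (T k v) = b • T k v - (b * (q - 1)) • v := by
      have h1 := h.quad_apply hk (jucysMurphy T k (T k v))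
      rw [hL1, map_smul] at h1
      have h2 : (q : ℂ) • jucysMurphy T k (T k v) =
          (q : ℂ) • (b • T k v - (b * (q - 1)) • v) := by
        rw [hbq] at h1
        rw [← sub_eq_iff_eq_add'.mpr h1]
        module
      exact smul_right_injective V hq0 h2
    have hne : b ≠ a k := by
      intro heq
      have hsemi := (isSymmetric_jucysMurphy hs hk.le).isFinitelySemisimple
      have h1 := hsemi.genEigenspace_eq_eigenspace (a k) (k := 2) (by norm_num)
      have h2 : T k v ∈ (jucysMurphy T k).genEigenspace (a k) (2 : ℕ) := by
        rw [mem_genEigenspace_nat, LinearMap.mem_ker, pow_two, Module.End.mul_apply]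
        simp only [LinearMap.sub_apply, LinearMap.smul_apply,
          Module.End.one_apply]
        rw [hLT, heq]
        simp only [map_sub, map_smul, hL0, hLT, heq]
        module
      rw [show ((2 : ℕ) : ℕ∞) = 2 from rfl, h1, mem_eigenspace_iff, hLT, heq] at h2
      have h3 : (a k * ((q : ℂ) - 1)) • v = 0 := by
        rw [← sub_eq_self (a := a k • T k v)]; exact h2
      exact (smul_ne_zero (mul_ne_zero ha0 hq1) hv.1) h3
    have hd : a k - b ≠ 0 := sub_ne_zero.mpr hne.symm
    refine ⟨fun j => if j = k then b else a j, b * (q - 1) / (a k - b), by simpa using hbq,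
      by simpa using hne, ?_, ?_⟩
    · intro h0
      refine hprop (-(b * (q - 1) / (a k - b))) ?_
      rw [neg_smul]; exact eq_neg_of_add_eq_zero_left h0
    · intro j hj
      rcases hj.eq_or_lt with rfl | hlt
      · simp only [if_true, map_add, map_smul, hLT, hL0]
        rw [smul_add, smul_smul, smul_smul, sub_eq_add_neg, add_assoc, ← neg_smul, ← add_smul]
        congr 2
        field_simp
        ring
      · have hc := h.commute_jucysMurphy_of_lt hlt hk
        have hc' : jucysMurphy T j (T k v) = T k (jucysMurphy T j v) := by
          have := congrArg (fun f => f v) hc.eq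
          simpa using this.symm
        simp only [hlt.ne, if_false, map_add, map_smul, hc', hv.2 j (by omega)]
        module

theorem weight_of_isTrivVec {k : ℕ} {a : ℕ → ℂ} {v : V} (hv : IsWeightVec T k a v)
    (ht : IsTrivVec q T k v) : a k = (q : ℂ) ^ (2 * k) := by
  have key : ∀ j ≤ k, jucysMurphy T j v = (q : ℂ) ^ (2 * j) • v := by
    intro j hj
    induction j with
    | zero => simp [jucysMurphy]
    | succ j ih =>
      simp only [jucysMurphy, Module.End.mul_apply, ht j hj, map_smul, ih (by omega), smul_smul]
      congr 1; ring
  have h1 := hv.2 k le_rfl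
  rw [key k le_rfl] at h1
  exact (smul_left_injective ℂ hv.1 h1).symm

theorem cast_pow_injective (hq : 2 ≤ q) {s t : ℕ} (hst : (q : ℂ) ^ s = (q : ℂ) ^ t) : s = t :=
  Nat.pow_right_injective hq (by exact_mod_cast hst)

variable [FiniteDimensional ℂ V]

theorem weight_eq_pow (h : HeckeRel q r T) (hq : 2 ≤ q) (hs : ∀ i < r, (T i).IsSymmetric)
    {k : ℕ} (hk : k ≤ r) {a : ℕ → ℂ} {v : V} (hv : IsWeightVec T k a v) :
    ∃ s : ℕ, a k = (q : ℂ) ^ s ∧ s ≤ 2 * k ∧ (s = 2 * k → IsTrivVec q T k v) := by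
  induction k generalizing a v with
  | zero =>
    refine ⟨0, ?_, le_rfl, fun _ i hi => absurd hi (Nat.not_lt_zero i)⟩
    have h1 : v = a 0 • v := hv.2 0 le_rfl
    have h2 : (1 : ℂ) • v = a 0 • v := by rw [one_smul]; exact h1
    simpa using (smul_left_injective ℂ hv.1 h2).symm
  | succ k ih =>
    obtain ⟨s, hs1, hs2, hs3⟩ := ih (by omega) (hv.mono (Nat.le_succ k))
    rcases h.weight_succ_cases hq hs hk hv with ⟨h1, h2⟩ | ⟨h1, h2⟩ | ⟨a', c, h1, h2, h3⟩
    · refine ⟨s + 2, by rw [h2, hs1]; ring, by omega, fun h4 => (hs3 (by omega)).succ h1⟩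
    · exact ⟨s, by rw [h2, hs1], by omega, fun h4 => by omega⟩
    · obtain ⟨t, ht1, ht2, -⟩ := ih (by omega) h3
      exact ⟨t + 1, by rw [h1, ht1]; ring, by omega, fun h4 => by omega⟩

theorem weight_of_isTrivVec_of_not_succ (h : HeckeRel q r T) (hq : 2 ≤ q)
    (hs : ∀ i < r, (T i).IsSymmetric) {k : ℕ} (hk : k < r) {a : ℕ → ℂ} {v : V}
    (hv : IsWeightVec T (k + 1) a v) (ht : IsTrivVec q T k v)
    (hnt : ¬ IsTrivVec q T (k + 1) v) : a (k + 1) = (q : ℂ) ^ k := by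
  have hq0 : (q : ℂ) ≠ 0 := by exact_mod_cast (by omega : q ≠ 0)
  induction k generalizing a v with
  | zero =>
    have h0 : a 0 = 1 := by simpa using weight_of_isTrivVec (hv.mono (Nat.zero_le 1)) ht
    rcases h.weight_succ_cases hq hs hk hv with ⟨h1, h2⟩ | ⟨h1, h2⟩ | ⟨a', c, h1, h2, h3⟩
    · exact absurd (ht.succ h1) hnt
    · simpa [h0] using h2
    · have h4 : a' 0 = 1 := by
        simpa using weight_of_isTrivVec (q := q) h3 (fun i hi => absurd hi (Nat.not_lt_zero i))
      exact absurd (h4.trans h0.symm) h2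
  | succ k ih =>
    rcases h.weight_succ_cases hq hs hk hv with ⟨h1, h2⟩ | ⟨h1, h2⟩ | ⟨a', c, h1, h2, h3⟩
    · exact absurd (ht.succ h1) hnt
    · exfalso
      have hb := h.braid_apply hk v
      simp only [ht k (Nat.lt_succ_self k), h1, map_smul, map_neg, smul_neg, smul_smul,
        neg_neg] at hb
      have hb2 : (-((q : ℂ) * q)) • v = (q : ℂ) • v := by rw [neg_smul]; exact hb
      have hb3 := smul_left_injective ℂ hv.1 hb2
      have hb4 : (q : ℂ) * (q + 1) = 0 := by linear_combination -hb3
      rcases mul_eq_zero.mp hb4 with h5 | h5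
      · exact hq0 h5
      · exact absurd h5 (by exact_mod_cast Nat.succ_ne_zero q)
    · have hak := weight_of_isTrivVec (hv.mono (Nat.le_succ (k + 1))) ht
      have hwt : IsTrivVec q T k (T (k + 1) v + c • v) := by
        intro i hi
        rw [map_add, h.comm_apply (by omega) hk, map_smul, ht i (by omega), map_smul]
        module
      have hwnt : ¬ IsTrivVec q T (k + 1) (T (k + 1) v + c • v) := fun hw =>
        h2 ((weight_of_isTrivVec h3 hw).trans hak.symm)
      rw [h1, ih (by omega) h3 hwt hwnt]
      ring

theorem prod_weight_of_not_isTrivVec (h : HeckeRel q r T) (hq : 2 ≤ q)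
    (hs : ∀ i < r, (T i).IsSymmetric) {k : ℕ} (hk : k ≤ r) {a : ℕ → ℂ} {v : V}
    (hv : IsWeightVec T k a v) (hnt : ¬ IsTrivVec q T k v) :
    ∃ s : ℕ, jucysMurphyProd T k v = (q : ℂ) ^ s • v ∧ s + (k + 1) ≤ k * (k + 1) := by
  have hprod : ∀ k : ℕ, IsWeightVec T k a v → IsTrivVec q T k v →
      jucysMurphyProd T k v = (q : ℂ) ^ (k * (k + 1)) • v := by
    intro k hv ht
    induction k with
    | zero => simp [jucysMurphyProd]
    | succ k ih =>
      rw [jucysMurphyProd, Module.End.mul_apply, ih (hv.mono (Nat.le_succ k))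
        (ht.mono (Nat.le_succ k)), map_smul, hv.2 _ le_rfl, weight_of_isTrivVec hv ht, smul_smul]
      congr 1; ring
  induction k with
  | zero => exact absurd (fun i hi => absurd hi (Nat.not_lt_zero i)) hnt
  | succ k ih =>
    by_cases ht : IsTrivVec q T k v
    · refine ⟨k * (k + 1) + k, ?_, by ring_nf; omega⟩
      rw [jucysMurphyProd, Module.End.mul_apply, hprod k (hv.mono (Nat.le_succ k)) ht, map_smul,
        hv.2 _ le_rfl, h.weight_of_isTrivVec_of_not_succ hq hs hk hv ht hnt, smul_smul]
      congr 1; ring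
    · obtain ⟨s, hs1, hs2⟩ := ih (by omega) (hv.mono (Nat.le_succ k)) ht
      obtain ⟨t, ht1, ht2, ht3⟩ := h.weight_eq_pow hq hs hk hv
      have ht4 : t ≠ 2 * (k + 1) := fun h5 => hnt (ht3 h5)
      refine ⟨s + t, ?_, ?_⟩
      · rw [jucysMurphyProd, Module.End.mul_apply, hs1, map_smul, hv.2 _ le_rfl, ht1, smul_smul]
        congr 1; ring
      · have : (k + 1) * (k + 1 + 1) = k * (k + 1) + 2 * (k + 1) := by ring
        omega

theorem apply_eq_of_isWeightVec (h : HeckeRel q r T) (hq : 2 ≤ q)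
    (hs : ∀ i < r, (T i).IsSymmetric) {p N : ℕ} (hp : p < r)
    (hno : ∀ v, IsTrivVec q T p v → v = 0) (hN : N + (p + 2) = (p + 1) * (p + 2))
    (hz : ∀ v, jucysMurphyProd T (p + 1) v = (q : ℂ) ^ N • v) {a : ℕ → ℂ} {v : V}
    (hv : IsWeightVec T (p + 1) a v) : T p v = (q : ℂ) • v := by
  have hq0 : (q : ℂ) ≠ 0 := by exact_mod_cast (by omega : q ≠ 0)
  have hnt : ¬ IsTrivVec q T p v := fun ht => hv.1 (hno v ht)
  obtain ⟨s, hs1, hs2⟩ := h.prod_weight_of_not_isTrivVec hq hs hp.le (hv.mono (Nat.le_succ p)) hnt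
  obtain ⟨t, ht1, ht2, ht3⟩ := h.weight_eq_pow hq hs hp hv
  have ht4 : t ≠ 2 * (p + 1) := fun h5 => hnt ((ht3 h5).mono (Nat.le_succ p))
  have h1 := hz v
  rw [jucysMurphyProd, Module.End.mul_apply, hs1, map_smul, hv.2 _ le_rfl, ht1, smul_smul,
    ← pow_add] at h1
  have h2 : s + t = N := cast_pow_injective hq (smul_left_injective ℂ hv.1 h1)
  have ht : t = 2 * p + 1 := by
    have e1 : (p + 1) * (p + 2) = p * (p + 1) + 2 * (p + 1) := by ring
    omega
  rcases h.weight_succ_cases hq hs hp hv with ⟨h1, -⟩ | ⟨-, h2⟩ | ⟨a', c, h1, -, h3⟩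
  · exact h1
  · obtain ⟨u, hu1, hu2, -⟩ := h.weight_eq_pow hq hs hp.le (hv.mono (Nat.le_succ p))
    rw [hu1, ht1] at h2
    have := cast_pow_injective hq h2
    omega
  · obtain ⟨u, hu1, hu2, hu3⟩ := h.weight_eq_pow hq hs hp.le h3
    have h4 : (q : ℂ) ^ t = (q : ℂ) ^ (u + 1) := by rw [← ht1, h1, hu1]; ring
    have := cast_pow_injective hq h4
    exact absurd (hno _ (hu3 (by omega))) h3.1

theorem eq_zero_of_forall_isTrivVec (h : HeckeRel q r T) (hq : 2 ≤ q)
    (hs : ∀ i < r, (T i).IsSymmetric) {p N : ℕ} (hp : p + 1 = r)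
    (hno : ∀ v, IsTrivVec q T p v → v = 0) (hN : N + (r + 1) = r * (r + 1))
    (hz : ∀ v, jucysMurphyProd T r v = (q : ℂ) ^ N • v) (v : V) : v = 0 := by
  subst hp
  have hq0 : (q : ℂ) ≠ 0 := by exact_mod_cast (by omega : q ≠ 0)
  have htop := LinearMap.IsSymmetric.iSup_iInf_eq_top_of_commute
    (T := fun j : Fin (p + 2) => jucysMurphy T j)
    (fun j => isSymmetric_jucysMurphy hs (by omega))
    (fun i j _ => by
      rcases le_total (i : ℕ) j with hij | hij
      · exact h.commute_jucysMurphy_jucysMurphy hij (by omega)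
      · exact (h.commute_jucysMurphy_jucysMurphy hij (by omega)).symm)
  have hTp : ∀ v, T p v = (q : ℂ) • v := by
    have hle : (⊤ : Submodule ℂ V) ≤ eigenspace (T p) (q : ℂ) := by
      rw [← htop]
      refine iSup_le fun χ v hv => ?_
      rw [mem_eigenspace_iff]
      by_cases hv0 : v = 0
      · simp [hv0]
      rw [Submodule.mem_iInf] at hv
      refine h.apply_eq_of_isWeightVec hq hs (Nat.lt_succ_self p) hno hN hz
        (a := fun j => if hj : j < p + 2 then χ ⟨j, hj⟩ else 0) ⟨hv0, fun j hj => ?_⟩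
      have := mem_eigenspace_iff.mp (hv ⟨j, by omega⟩)
      simpa [show j < p + 2 by omega] using this
    exact fun v => mem_eigenspace_iff.mp (hle Submodule.mem_top)
  have hall : ∀ j ≤ p, ∀ v, T (p - j) v = (q : ℂ) • v := by
    intro j hj
    induction j with
    | zero => exact hTp
    | succ j ih =>
      intro v
      have hb := h.braid_apply (i := p - (j + 1)) (by omega) v
      rw [show p - (j + 1) + 1 = p - j by omega] at hb
      simp only [ih (by omega), map_smul] at hb
      have h1 := h.quad_apply (i := p - (j + 1)) (by omega) v
      have h2 : T (p - (j + 1)) (T (p - (j + 1)) v) = (q : ℂ) • T (p - (j + 1)) v :=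
        smul_right_injective V hq0 hb
      rw [h2] at h1
      have h3 : T (p - (j + 1)) v - (q : ℂ) • v = 0 := by
        have h4 := sub_eq_zero.mpr h1
        rw [← h4]; module
      exact sub_eq_zero.mp h3
  refine hno v fun i hi => ?_
  have := hall (p - i) (by omega) v
  rwa [show p - (p - i) = i by omega] at this

/-- The second largest eigenspace of the central element `jucysMurphyProd T r` is contained in
every invariant subspace which contains all vectors spanning a trivial module of the parabolic
subalgebra of corank one. -/
theorem mem_of_jucysMurphyProd_apply_eq (h : HeckeRel q r T) (hq : 2 ≤ q)
    (hs : ∀ i < r, (T i).IsSymmetric) {p N : ℕ} (hp : p + 1 = r) (hN : N + (r + 1) = r * (r + 1))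
    (W : Submodule ℂ V) (hW : ∀ i < r, ∀ w ∈ W, T i w ∈ W)
    (htW : ∀ v, IsTrivVec q T p v → v ∈ W) {v : V}
    (hv : jucysMurphyProd T r v = (q : ℂ) ^ N • v) : v ∈ W := by
  set M : Submodule ℂ V := Wᗮ ⊓ eigenspace (jucysMurphyProd T r) ((q : ℂ) ^ N) with hM
  have hTperp : ∀ i < r, ∀ w ∈ Wᗮ, T i w ∈ Wᗮ := by
    intro i hi w hw
    rw [Submodule.mem_orthogonal] at hw ⊢
    intro u hu
    rw [← hs i hi]
    exact hw _ (hW i hi u hu)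
  have hTM : ∀ i < r, ∀ w ∈ M, T i w ∈ M := by
    intro i hi w hw
    refine ⟨hTperp i hi w hw.1, ?_⟩
    have h1 := mem_eigenspace_iff.mp hw.2
    have h2 := congrArg (fun f => f w) (h.commute_jucysMurphyProd le_rfl hi).eq
    simp only [Module.End.mul_apply] at h2
    exact mem_eigenspace_iff.mpr (by rw [← h2, h1, map_smul])
  let S : ℕ → Module.End ℂ M := fun i => if hi : i < r then (T i).restrict (hTM i hi) else 0
  have hS : ∀ i < r, ∀ w : M, (S i w : V) = T i w := by
    intro i hi w
    simp [S, hi]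
  have hSrel : HeckeRel q r S := by
    refine ⟨fun i hi => ?_, fun i hi => ?_, fun i j hij hj => ?_⟩
    · ext w
      simp [hS i hi, h.quad_apply hi]
    · ext w
      simp [hS i (by omega), hS (i + 1) hi, h.braid_apply hi]
    · ext w
      simp [hS i (by omega), hS j hj, h.comm_apply hij hj]
  have hSs : ∀ i < r, (S i).IsSymmetric := by
    intro i hi x y
    rw [Submodule.coe_inner, Submodule.coe_inner, hS i hi, hS i hi]
    exact hs i hi x y
  have hSL : ∀ k ≤ r, ∀ w : M, (jucysMurphy S k w : V) = jucysMurphy T k w := by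
    intro k hk
    induction k with
    | zero => intro w; rfl
    | succ k ih =>
      intro w
      simp only [jucysMurphy, Module.End.mul_apply]
      rw [hS k hk, ih (by omega), hS k hk]
  have hSz : ∀ k ≤ r, ∀ w : M, (jucysMurphyProd S k w : V) = jucysMurphyProd T k w := by
    intro k hk
    induction k with
    | zero => intro w; rfl
    | succ k ih =>
      intro w
      simp only [jucysMurphyProd, Module.End.mul_apply]
      rw [hSL _ hk, ih (by omega)]
  have hM0 : ∀ w : M, w = 0 := by
    refine hSrel.eq_zero_of_forall_isTrivVec hq hSs hp (fun w hw => ?_) hN (fun w => ?_)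
    · have hwW : (w : V) ∈ W := by
        refine htW _ fun i hi => ?_
        rw [← hS i (by omega), hw i hi]; rfl
      exact Subtype.ext (inner_self_eq_zero.mp ((Submodule.mem_orthogonal _ _).mp w.2.1 _ hwW))
    · apply Subtype.ext
      rw [hSz r le_rfl, mem_eigenspace_iff.mp w.2.2]; rfl
  have hLinv : ∀ U : Submodule ℂ V, (∀ i < r, ∀ w ∈ U, T i w ∈ U) → ∀ k ≤ r, ∀ w ∈ U,
      jucysMurphyProd T k w ∈ U := by
    intro U hU
    have hJ : ∀ k ≤ r, ∀ w ∈ U, jucysMurphy T k w ∈ U := by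
      intro k hk
      induction k with
      | zero => exact fun w hw => hw
      | succ k ih => exact fun w hw => hU k hk _ (ih (by omega) _ (hU k hk w hw))
    intro k hk
    induction k with
    | zero => exact fun w hw => hw
    | succ k ih => exact fun w hw => hJ _ hk _ (ih (by omega) w hw)
  obtain ⟨y, hy, z, hz, rfl⟩ := W.exists_add_mem_mem_orthogonal v
  have h1 : jucysMurphyProd T r z - (q : ℂ) ^ N • z =
      -(jucysMurphyProd T r y - (q : ℂ) ^ N • y) := by
    rw [map_add] at hv
    rw [← sub_eq_zero] at hv ⊢
    rw [← hv]; module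
  have h2 : jucysMurphyProd T r z - (q : ℂ) ^ N • z ∈ Wᗮ :=
    sub_mem (hLinv _ hTperp r le_rfl z hz) (Wᗮ.smul_mem _ hz)
  have h3 : jucysMurphyProd T r z - (q : ℂ) ^ N • z ∈ W := by
    rw [h1]
    exact neg_mem (sub_mem (hLinv _ hW r le_rfl y hy) (W.smul_mem _ hy))
  have h4 : jucysMurphyProd T r z = (q : ℂ) ^ N • z := by
    rw [← sub_eq_zero]
    exact inner_self_eq_zero.mp ((Submodule.mem_orthogonal _ _).mp h2 _ h3)
  have h5 := hM0 ⟨z, hz, mem_eigenspace_iff.mpr h4⟩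
  have h6 : z = 0 := congrArg Subtype.val h5
  rw [h6, add_zero]
  exact hy

end HeckeRel

end Spectral

/-- The `0`-`1` matrix of a relation. -/
noncomputable def relMatrix {X : Type*} (R : X → X → Prop) : Matrix X X ℂ :=
  open Classical in fun c d => if R c d then 1 else 0

theorem relMatrix_mul {X : Type*} [Fintype X] {R S U : X → X → Prop}
    (h : ∀ c d, U c d ↔ ∃ e, R c e ∧ S e d)
    (hu : ∀ c d e e', R c e → S e d → R c e' → S e' d → e = e') :
    relMatrix R * relMatrix S = relMatrix U := by
  classical
  ext c d
  simp only [Matrix.mul_apply, relMatrix, ← ite_and, mul_ite, mul_one, mul_zero]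
  by_cases hU : U c d
  · obtain ⟨e, he1, he2⟩ := (h c d).mp hU
    rw [if_pos hU, Finset.sum_eq_single e, if_pos ⟨he2, he1⟩]
    · intro e' _ hne
      rw [if_neg]
      exact fun h' => hne (hu c d e' e h'.2 h'.1 he1 he2)
    · intro h'; exact absurd (Finset.mem_univ e) h'
  · rw [if_neg hU]
    refine Finset.sum_eq_zero fun e _ => if_neg fun h' => hU ((h c d).mpr ⟨e, h'.2, h'.1⟩)

theorem relMatrix_transpose {X : Type*} {R : X → X → Prop} (h : ∀ c d, R c d → R d c) :
    (relMatrix R)ᵀ = relMatrix R := by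
  classical
  ext c d
  simp only [Matrix.transpose_apply, relMatrix]
  congr 1
  exact propext ⟨h d c, h c d⟩

theorem relMatrix_eq_one {X : Type*} [DecidableEq X] {R : X → X → Prop}
    (h : ∀ c d, R c d ↔ c = d) : relMatrix R = 1 := by
  classical
  ext c d
  simp only [relMatrix, Matrix.one_apply, h]

namespace MaxFlag2

section Basic

variable {F : Type} [Field F] {m : ℕ}

theorem flagMem2_of_le (c : MaxFlag2 F m) {k : ℕ} (hk : k ≤ 2 * m) :
    flagMem2 c k = c.1 ⟨k, by omega⟩ := dif_pos _

theorem finrank_flagMem2 (c : MaxFlag2 F m) {k : ℕ} (hk : k ≤ 2 * m) :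
    Module.finrank F (flagMem2 c k) = k := by
  rw [flagMem2_of_le c hk]; exact c.2.2 _

theorem flagMem2_eq_top (c : MaxFlag2 F m) {k : ℕ} (hk : 2 * m ≤ k) : flagMem2 c k = ⊤ := by
  rcases hk.eq_or_lt with rfl | hlt
  · apply Submodule.eq_top_of_finrank_eq
    rw [finrank_flagMem2 c le_rfl]; simp
  · exact dif_neg (by omega)

theorem flagMem2_mono (c : MaxFlag2 F m) {i j : ℕ} (hij : i ≤ j) :
    flagMem2 c i ≤ flagMem2 c j := by
  by_cases hj : j ≤ 2 * m
  · rw [flagMem2_of_le c hj, flagMem2_of_le c (hij.trans hj)]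
    exact c.2.1 hij
  · rw [flagMem2_eq_top c (by omega : 2 * m ≤ j)]; exact le_top

theorem flagMem2_zero (c : MaxFlag2 F m) : flagMem2 c 0 = ⊥ :=
  Submodule.finrank_eq_zero.mp (finrank_flagMem2 c (Nat.zero_le _))

theorem ext_flagMem2 {c d : MaxFlag2 F m} (h : ∀ k, flagMem2 c k = flagMem2 d k) : c = d := by
  apply Subtype.ext
  funext k
  have := h k
  rwa [flagMem2_of_le c (by omega), flagMem2_of_le d (by omega)] at this

theorem exists_flagMem2_eq (g : ℕ → Submodule F (Fin (2 * m) → F))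
    (hg : ∀ i < 2 * m, g i ≤ g (i + 1)) (hr : ∀ i ≤ 2 * m, Module.finrank F (g i) = i) :
    ∃ e : MaxFlag2 F m, ∀ i ≤ 2 * m, flagMem2 e i = g i := by
  have hmono : ∀ j ≤ 2 * m, ∀ i ≤ j, g i ≤ g j := by
    intro j hj
    induction j with
    | zero => intro i hi; rw [Nat.le_zero.mp hi]
    | succ j ih =>
      intro i hi
      rcases hi.eq_or_lt with rfl | hlt
      · exact le_rfl
      · exact (ih (by omega) i (by omega)).trans (hg j hj)
  refine ⟨⟨fun k => g k, fun i j hij => hmono j (by omega) i hij, fun k => hr k (by omega)⟩,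
    fun i hi => flagMem2_of_le _ hi⟩

theorem exists_update (c : MaxFlag2 F m) {i : ℕ} (hi : i + 1 < 2 * m)
    {X : Submodule F (Fin (2 * m) → F)} (h1 : flagMem2 c i ≤ X) (h2 : X ≤ flagMem2 c (i + 2))
    (hX : Module.finrank F X = i + 1) :
    ∃ e : MaxFlag2 F m, flagMem2 e (i + 1) = X ∧ ∀ j, j ≠ i + 1 → flagMem2 e j = flagMem2 c j := by
  have hg : ∀ j < 2 * m, (if j = i + 1 then X else flagMem2 c j) ≤
      if j + 1 = i + 1 then X else flagMem2 c (j + 1) := by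
    intro j hj
    rcases eq_or_ne j (i + 1) with rfl | hne
    · rw [if_pos rfl, if_neg (by omega)]; exact h2
    · rw [if_neg hne]
      rcases eq_or_ne j i with rfl | hne2
      · rw [if_pos rfl]; exact h1
      · rw [if_neg (by omega)]; exact flagMem2_mono c (Nat.le_succ j)
  have hr : ∀ j ≤ 2 * m,
      Module.finrank F ↥(if j = i + 1 then X else flagMem2 c j) = j := by
    intro j hj
    by_cases h : j = i + 1
    · rw [if_pos h, hX, h]
    · rw [if_neg h]; exact finrank_flagMem2 c hj
  obtain ⟨e, he⟩ := exists_flagMem2_eq (fun j => if j = i + 1 then X else flagMem2 c j) hg hr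
  refine ⟨e, by rw [he _ (by omega), if_pos rfl], fun j hj => ?_⟩
  by_cases hj2 : j ≤ 2 * m
  · rw [he j hj2, if_neg hj]
  · rw [flagMem2_eq_top e (by omega), flagMem2_eq_top c (by omega)]

theorem eq_flagMem2_of_le {X : Submodule F (Fin (2 * m) → F)} (c : MaxFlag2 F m) {i : ℕ}
    (hi : i ≤ 2 * m) (h : X ≤ flagMem2 c i) (hX : i ≤ Module.finrank F X) : X = flagMem2 c i :=
  Submodule.eq_of_le_of_finrank_le h (by rwa [finrank_flagMem2 c hi])

theorem flagMem2_eq_of_le (c d : MaxFlag2 F m) {i : ℕ} (h : flagMem2 c i ≤ flagMem2 d i) :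
    flagMem2 c i = flagMem2 d i := by
  by_cases hi : i ≤ 2 * m
  · exact eq_flagMem2_of_le d hi h (finrank_flagMem2 c hi).ge
  · rw [flagMem2_eq_top c (by omega), flagMem2_eq_top d (by omega)]

/-- Two flags agree except possibly in dimension `i + 1`. -/
def Panel (i : ℕ) (c d : MaxFlag2 F m) : Prop :=
  ∀ j, j ≠ i + 1 → flagMem2 c j = flagMem2 d j

/-- Two flags agree except exactly in dimension `i + 1`. -/
def Adjacent (i : ℕ) (c d : MaxFlag2 F m) : Prop :=
  Panel i c d ∧ flagMem2 c (i + 1) ≠ flagMem2 d (i + 1)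

theorem Panel.symm {i : ℕ} {c d : MaxFlag2 F m} (h : Panel i c d) : Panel i d c :=
  fun j hj => (h j hj).symm

theorem Panel.trans {i : ℕ} {c d e : MaxFlag2 F m} (h : Panel i c d) (h' : Panel i d e) :
    Panel i c e := fun j hj => (h j hj).trans (h' j hj)

theorem Adjacent.symm {i : ℕ} {c d : MaxFlag2 F m} (h : Adjacent i c d) : Adjacent i d c :=
  ⟨h.1.symm, h.2.symm⟩

theorem Panel.ext {i : ℕ} {c d : MaxFlag2 F m} (h : Panel i c d)
    (h' : flagMem2 c (i + 1) = flagMem2 d (i + 1)) : c = d := by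
  apply ext_flagMem2
  intro k
  rcases eq_or_ne k (i + 1) with rfl | hk
  · exact h'
  · exact h k hk

theorem Panel.eq_of_mem {i : ℕ} (hi : i + 1 < 2 * m) {c d e : MaxFlag2 F m} (hd : Panel i c d)
    (he : Panel i c e) {x : Fin (2 * m) → F} (hx : x ∉ flagMem2 c i)
    (hxd : x ∈ flagMem2 d (i + 1)) (hxe : x ∈ flagMem2 e (i + 1)) : d = e := by
  have key : ∀ e : MaxFlag2 F m, Panel i c e → x ∈ flagMem2 e (i + 1) →
      flagMem2 c i ⊔ Submodule.span F {x} = flagMem2 e (i + 1) := by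
    intro e he hxe
    apply eq_flagMem2_of_le e (by omega)
    · refine sup_le ?_ ((Submodule.span_singleton_le_iff_mem _ _).mpr hxe)
      rw [he i (by omega)]
      exact flagMem2_mono e (Nat.le_succ i)
    · rw [Submodule.finrank_sup_span_singleton hx, finrank_flagMem2 c (by omega)]
  exact (hd.symm.trans he).ext ((key d hd hxd).symm.trans (key e he hxe))

theorem exists_panel_mem (c : MaxFlag2 F m) {i : ℕ} (hi : i + 1 < 2 * m)
    {x : Fin (2 * m) → F} (hx : x ∉ flagMem2 c i) (hx2 : x ∈ flagMem2 c (i + 2)) :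
    ∃ e, Panel i c e ∧ x ∈ flagMem2 e (i + 1) := by
  obtain ⟨e, he1, he2⟩ := exists_update c hi (X := flagMem2 c i ⊔ Submodule.span F {x})
    le_sup_left
    (sup_le (flagMem2_mono c (by omega)) ((Submodule.span_singleton_le_iff_mem _ _).mpr hx2))
    (by rw [Submodule.finrank_sup_span_singleton hx, finrank_flagMem2 c (by omega)])
  refine ⟨e, fun j hj => (he2 j hj).symm, ?_⟩
  rw [he1]
  exact Submodule.mem_sup_right (Submodule.mem_span_singleton_self x)

end Basic

section Counting

variable {F : Type} [Field F] [Fintype F] {m : ℕ}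

theorem natCard_flagMem2 (c : MaxFlag2 F m) {k : ℕ} (hk : k ≤ 2 * m) :
    Nat.card (flagMem2 c k) = Fintype.card F ^ k := by
  rw [Module.natCard_eq_pow_finrank (K := F), finrank_flagMem2 c hk, Nat.card_eq_fintype_card]

open Classical in
theorem card_flagMem2_filter (c : MaxFlag2 F m) {k : ℕ} (hk : k ≤ 2 * m) :
    (Finset.univ.filter fun x : Fin (2 * m) → F => x ∈ flagMem2 c k).card =
      Fintype.card F ^ k := by
  rw [← natCard_flagMem2 c hk, Nat.card_eq_fintype_card, Fintype.card_subtype]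

open Classical in
theorem card_panel (c : MaxFlag2 F m) {i : ℕ} (hi : i + 1 < 2 * m) :
    (Finset.univ.filter fun e => Panel i c e).card = Fintype.card F + 1 := by
  set q := Fintype.card F with hq
  have hq2 : 2 ≤ q := Fintype.one_lt_card
  let D : ∀ (_ : MaxFlag2 F m) (_ : ℕ), Finset (Fin (2 * m) → F) :=
    fun e k => Finset.univ.filter fun x => x ∈ flagMem2 e k ∧ x ∉ flagMem2 c i
  have hD : ∀ (e : MaxFlag2 F m) (k : ℕ), i ≤ k → k ≤ 2 * m → flagMem2 e i = flagMem2 c i →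
      (D e k).card + q ^ i = q ^ k := by
    intro e k hik hk hei
    have h1 := card_flagMem2_filter c (k := i) (by omega)
    have h2 := card_flagMem2_filter e hk
    rw [← hq] at h1 h2
    rw [← h1, ← h2, ← Finset.card_filter_add_card_filter_not (s := Finset.univ.filter
      fun x => x ∈ flagMem2 e k) (fun x => x ∈ flagMem2 c i), add_comm]
    congr 1
    · congr 1
      ext x
      simp only [Finset.mem_filter, Finset.mem_univ, true_and]
      exact ⟨fun hx => ⟨flagMem2_mono e hik (hei ▸ hx), hx⟩, fun hx => hx.2⟩
    · congr 1
      ext x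
      simp [D]
  have hmaps : D c (i + 2) = (Finset.univ.filter fun e => Panel i c e).biUnion
      fun e => D e (i + 1) := by
    ext x
    simp only [D, Finset.mem_filter, Finset.mem_univ, true_and, Finset.mem_biUnion]
    constructor
    · rintro ⟨h1, h2⟩
      obtain ⟨e, he1, he2⟩ := exists_panel_mem c hi h2 h1
      exact ⟨e, he1, he2, h2⟩
    · rintro ⟨e, he1, he2, h2⟩
      refine ⟨?_, h2⟩
      rw [he1 (i + 2) (by omega)]
      exact flagMem2_mono e (by omega) he2
  have hcard := congrArg Finset.card hmaps
  rw [Finset.card_biUnion, Finset.sum_congr rfl (g := fun _ => q ^ (i + 1) - q ^ i),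
    Finset.sum_const, smul_eq_mul] at hcard
  · have h1 := hD c (i + 2) (by omega) (by omega) rfl
    rw [hcard] at h1
    set N := (Finset.univ.filter fun e => Panel i c e).card
    have h2 : q ^ i ≤ q ^ (i + 1) := Nat.pow_le_pow_right (by omega) (by omega)
    zify [h2] at h1 ⊢
    have h3 : ((q : ℤ) ^ i * (q - 1)) * (N - (q + 1)) = 0 := by
      rw [pow_succ, pow_add] at h1
      linear_combination h1
    have h4 : (q : ℤ) ^ i * (q - 1) ≠ 0 := by
      refine mul_ne_zero (pow_ne_zero _ (by omega)) (by omega)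
    have h5 := (mul_eq_zero.mp h3).resolve_left h4
    linarith
  · intro e he
    have := hD e (i + 1) (by omega) (by omega)
      (((Finset.mem_filter.mp he).2 i (by omega)).symm)
    omega
  · intro e he e' he' hne
    rw [Function.onFun, Finset.disjoint_left]
    intro x hx hx'
    simp only [D, Finset.coe_filter, Set.mem_ofPred_eq, Finset.mem_filter, Finset.mem_univ,
      true_and] at he he' hx hx'
    exact hne (he.eq_of_mem hi he' hx.2 hx.1 hx'.1)

end Counting

section Hecke

variable {F : Type} [Field F] {m : ℕ}

theorem Panel.rfl {i : ℕ} {c : MaxFlag2 F m} : Panel i c c := fun _ _ => Eq.refl _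

theorem relMatrix_adjacent_mul_adjacent [Fintype F] {i j : ℕ} (hi : i + 1 < 2 * m) (hij : i ≠ j)
    (hij1 : i + 1 ≠ j) (hij2 : j + 1 ≠ i) :
    relMatrix (Adjacent (F := F) (m := m) i) * relMatrix (Adjacent j) =
      relMatrix fun c d => (∀ k, k ≠ i + 1 → k ≠ j + 1 → flagMem2 c k = flagMem2 d k) ∧
        flagMem2 c (i + 1) ≠ flagMem2 d (i + 1) ∧ flagMem2 c (j + 1) ≠ flagMem2 d (j + 1) := by
  apply relMatrix_mul
  · intro c d
    constructor
    · rintro ⟨h1, h2, h3⟩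
      obtain ⟨e, he1, he2⟩ := exists_update c hi (X := flagMem2 d (i + 1))
        (by rw [h1 i (by omega) (by omega)]; exact flagMem2_mono d (Nat.le_succ i))
        (by rw [h1 (i + 2) (by omega) (by omega)]; exact flagMem2_mono d (Nat.le_succ _))
        (finrank_flagMem2 d (by omega))
      refine ⟨e, ⟨fun k hk => (he2 k hk).symm, by rwa [he1]⟩, fun k hk => ?_, ?_⟩
      · rcases eq_or_ne k (i + 1) with rfl | hk2
        · exact he1
        · rw [he2 k hk2, h1 k hk2 hk]
      · rwa [he2 _ (by omega)]
    · rintro ⟨e, ⟨h1, h2⟩, h3, h4⟩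
      refine ⟨fun k hk hk2 => (h1 k hk).trans (h3 k hk2), ?_, ?_⟩
      · rwa [← h3 _ (by omega)]
      · rwa [h1 _ (by omega)]
  · intro c d e e' h1 h2 h3 h4
    exact (h1.1.symm.trans h3.1).ext ((h2.1 _ (by omega)).trans (h4.1 _ (by omega)).symm)

theorem finrank_inf_of_ne (c d : MaxFlag2 F m) {i : ℕ} (hi : i + 2 ≤ 2 * m)
    (h : flagMem2 c (i + 2) = flagMem2 d (i + 2))
    (hne : flagMem2 c (i + 1) ≠ flagMem2 d (i + 1)) :
    Module.finrank F ↥(flagMem2 c (i + 1) ⊓ flagMem2 d (i + 1)) = i := by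
  have h1 := Submodule.finrank_sup_add_finrank_inf_eq (flagMem2 c (i + 1)) (flagMem2 d (i + 1))
  rw [finrank_flagMem2 c (by omega), finrank_flagMem2 d (by omega)] at h1
  have h2 : Module.finrank F ↥(flagMem2 c (i + 1) ⊔ flagMem2 d (i + 1)) ≤ i + 2 := by
    rw [← finrank_flagMem2 c hi]
    apply Submodule.finrank_mono
    exact sup_le (flagMem2_mono c (by omega)) (h ▸ flagMem2_mono d (by omega))
  have h3 : Module.finrank F ↥(flagMem2 c (i + 1) ⊓ flagMem2 d (i + 1)) < i + 1 := by
    refine (Submodule.finrank_lt_finrank_of_lt (t := flagMem2 c (i + 1)) ?_).trans_eq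
      (finrank_flagMem2 c (by omega))
    refine lt_of_le_of_ne inf_le_left fun h' => hne ?_
    exact flagMem2_eq_of_le c d (inf_eq_left.mp h')
  omega

theorem finrank_sup_of_ne (c d : MaxFlag2 F m) {i : ℕ} (hi : i + 1 ≤ 2 * m)
    (h : flagMem2 c i = flagMem2 d i) (hne : flagMem2 c (i + 1) ≠ flagMem2 d (i + 1)) :
    Module.finrank F ↥(flagMem2 c (i + 1) ⊔ flagMem2 d (i + 1)) = i + 2 := by
  have h1 := Submodule.finrank_sup_add_finrank_inf_eq (flagMem2 c (i + 1)) (flagMem2 d (i + 1))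
  rw [finrank_flagMem2 c (by omega), finrank_flagMem2 d (by omega)] at h1
  have h2 : i ≤ Module.finrank F ↥(flagMem2 c (i + 1) ⊓ flagMem2 d (i + 1)) := by
    refine (finrank_flagMem2 c (by omega)).ge.trans (Submodule.finrank_mono ?_)
    exact le_inf (flagMem2_mono c (by omega)) (h ▸ flagMem2_mono d (by omega))
  have h3 : Module.finrank F ↥(flagMem2 c (i + 1) ⊓ flagMem2 d (i + 1)) < i + 1 := by
    refine (Submodule.finrank_lt_finrank_of_lt (t := flagMem2 c (i + 1)) ?_).trans_eq
      (finrank_flagMem2 c (by omega))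
    refine lt_of_le_of_ne inf_le_left fun h' => hne ?_
    exact flagMem2_eq_of_le c d (inf_eq_left.mp h')
  omega

theorem relMatrix_adjacent_mul_adjacent_succ [Fintype F] {i : ℕ} (hi : i + 1 < 2 * m) :
    relMatrix (Adjacent (F := F) (m := m) i) * relMatrix (Adjacent (i + 1)) =
      relMatrix fun c d => (∀ k, k ≠ i + 1 → k ≠ i + 2 → flagMem2 c k = flagMem2 d k) ∧
        flagMem2 d (i + 1) ≤ flagMem2 c (i + 2) ∧
        flagMem2 c (i + 1) ≠ flagMem2 d (i + 1) ∧ flagMem2 c (i + 2) ≠ flagMem2 d (i + 2) := by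
  apply relMatrix_mul
  · intro c d
    constructor
    · rintro ⟨h1, h0, h2, h3⟩
      obtain ⟨e, he1, he2⟩ := exists_update c hi (X := flagMem2 d (i + 1))
        (by rw [h1 i (by omega) (by omega)]; exact flagMem2_mono d (Nat.le_succ i)) h0
        (finrank_flagMem2 d (by omega))
      refine ⟨e, ⟨fun k hk => (he2 k hk).symm, by rwa [he1]⟩, fun k hk => ?_, ?_⟩
      · rcases eq_or_ne k (i + 1) with rfl | hk2
        · exact he1
        · rw [he2 k hk2, h1 k hk2 hk]
      · rwa [he2 _ (by omega)]
    · rintro ⟨e, ⟨h1, h2⟩, h3, h4⟩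
      refine ⟨fun k hk hk2 => (h1 k hk).trans (h3 k hk2), ?_, ?_, ?_⟩
      · rw [h1 _ (by omega), ← h3 _ (by omega)]
        exact flagMem2_mono e (Nat.le_succ _)
      · rwa [← h3 _ (by omega)]
      · rwa [h1 _ (by omega)]
  · intro c d e e' h1 h2 h3 h4
    exact (h1.1.symm.trans h3.1).ext ((h2.1 _ (by omega)).trans (h4.1 _ (by omega)).symm)

theorem relMatrix_adjacent_braid [Fintype F] {i : ℕ} (hi : i + 2 < 2 * m) :
    relMatrix (Adjacent (F := F) (m := m) i) * relMatrix (Adjacent (i + 1)) *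
      relMatrix (Adjacent i) =
    relMatrix (Adjacent (i + 1)) * relMatrix (Adjacent i) * relMatrix (Adjacent (i + 1)) := by
  rw [mul_assoc (relMatrix (Adjacent (i + 1))),
    relMatrix_adjacent_mul_adjacent_succ (by omega)]
  have eq_sup : ∀ c d e : MaxFlag2 F m, Panel (i + 1) c e →
      (∀ k, k ≠ i + 1 → k ≠ i + 2 → flagMem2 e k = flagMem2 d k) →
      flagMem2 d (i + 1) ≤ flagMem2 e (i + 2) → flagMem2 e (i + 1) ≠ flagMem2 d (i + 1) →
      flagMem2 e (i + 2) = flagMem2 c (i + 1) ⊔ flagMem2 d (i + 1) := by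
    intro c d e h5 h1 h2 h3
    rw [← h5 (i + 1) (by omega)] at h3
    symm
    apply eq_flagMem2_of_le e (by omega)
    · exact sup_le (h5 (i + 1) (by omega) ▸ flagMem2_mono e (Nat.le_succ _)) h2
    · apply le_of_eq
      symm
      apply finrank_sup_of_ne c d (by omega) _ h3
      rw [h5 i (by omega), h1 i (by omega) (by omega)]
  trans relMatrix fun c d : MaxFlag2 F m =>
      (∀ k, k ≠ i + 1 → k ≠ i + 2 → flagMem2 c k = flagMem2 d k) ∧
        ¬ flagMem2 c (i + 1) ≤ flagMem2 d (i + 2) ∧ ¬ flagMem2 d (i + 1) ≤ flagMem2 c (i + 2)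
  · apply relMatrix_mul
    · intro c d
      constructor
      · rintro ⟨h1, h2, h3⟩
        have hne : flagMem2 c (i + 2) ≠ flagMem2 d (i + 2) :=
          fun h => h2 (h ▸ flagMem2_mono c (Nat.le_succ _))
        obtain ⟨e, he1, he2⟩ := exists_update d (i := i) (by omega)
          (X := flagMem2 c (i + 2) ⊓ flagMem2 d (i + 2))
          (le_inf ((h1 i (by omega) (by omega)) ▸ flagMem2_mono c (by omega))
            (flagMem2_mono d (by omega))) inf_le_right
          (finrank_inf_of_ne c d (by omega) (h1 _ (by omega) (by omega)) hne)
        refine ⟨e, ⟨fun k hk hk2 => ?_, ?_, ?_, ?_⟩, fun k hk => he2 k hk, ?_⟩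
        · rw [he2 k hk, h1 k hk hk2]
        · rw [he1]; exact inf_le_left
        · rw [he1]; intro h; rw [h] at h2; exact h2 inf_le_right
        · rwa [he2 _ (by omega)]
        · rw [he1]; intro h; rw [← h] at h3; exact h3 inf_le_left
      · rintro ⟨e, ⟨h1, h2, h3, h4⟩, h5, h6⟩
        have hne : flagMem2 c (i + 2) ≠ flagMem2 d (i + 2) := by rwa [← h5 _ (by omega)]
        have h7 : flagMem2 c (i + 3) = flagMem2 d (i + 3) := by
          rw [h1 _ (by omega) (by omega), h5 _ (by omega)]
        have hr := (finrank_inf_of_ne c d (i := i + 1) (by omega) h7 hne)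
        have hle : flagMem2 e (i + 1) ≤ flagMem2 c (i + 2) ⊓ flagMem2 d (i + 2) :=
          le_inf h2 ((flagMem2_mono e (Nat.le_succ _)).trans_eq (h5 (i + 2) (by omega)))
        have heq : flagMem2 e (i + 1) = flagMem2 c (i + 2) ⊓ flagMem2 d (i + 2) :=
          Submodule.eq_of_le_of_finrank_le hle (by rw [hr, finrank_flagMem2 e (by omega)])
        refine ⟨fun k hk hk2 => (h1 k hk hk2).trans (h5 k hk), fun h => h3 ?_, fun h => h6 ?_⟩
        · apply flagMem2_eq_of_le
          rw [heq]; exact le_inf (flagMem2_mono c (Nat.le_succ _)) h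
        · apply Eq.symm
          apply flagMem2_eq_of_le
          rw [heq]; exact le_inf h (flagMem2_mono d (Nat.le_succ _))
    · rintro c d e e' ⟨h1, h2, h3, h4⟩ h5 ⟨h1', h2', h3', h4'⟩ h5'
      refine Panel.ext (h5.1.trans h5'.1.symm) ?_
      have hne : flagMem2 c (i + 2) ≠ flagMem2 d (i + 2) := by rwa [← h5.1 _ (by omega)]
      have h7 : flagMem2 c (i + 3) = flagMem2 d (i + 3) := by
        rw [h1 _ (by omega) (by omega), h5.1 _ (by omega)]
      have hr := (finrank_inf_of_ne c d (i := i + 1) (by omega) h7 hne)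
      rw [Submodule.eq_of_le_of_finrank_le (le_inf h2 ((flagMem2_mono e (Nat.le_succ _)).trans_eq
          (h5.1 (i + 2) (by omega)))) (by rw [hr, finrank_flagMem2 e (by omega)]),
        Submodule.eq_of_le_of_finrank_le (le_inf h2' ((flagMem2_mono e' (Nat.le_succ _)).trans_eq
          (h5'.1 (i + 2) (by omega)))) (by rw [hr, finrank_flagMem2 e' (by omega)])]
  · symm
    apply relMatrix_mul
    · intro c d
      constructor
      · rintro ⟨h1, h2, h3⟩
        have hne : flagMem2 c (i + 1) ≠ flagMem2 d (i + 1) :=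
          fun h => h3 (h ▸ flagMem2_mono c (Nat.le_succ _))
        obtain ⟨e, he1, he2⟩ := exists_update c (i := i + 1) (by omega)
          (X := flagMem2 c (i + 1) ⊔ flagMem2 d (i + 1)) le_sup_left
          (sup_le (flagMem2_mono c (by omega))
            ((h1 (i + 3) (by omega) (by omega)) ▸ flagMem2_mono d (by omega)))
          (finrank_sup_of_ne c d (by omega) (h1 _ (by omega) (by omega)) hne)
        refine ⟨e, ⟨fun k hk => (he2 k hk).symm, ?_⟩, fun k hk hk2 => ?_, ?_, ?_, ?_⟩
        · rw [he1]; intro h; rw [h] at h3; exact h3 le_sup_right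
        · rw [he2 k hk2, h1 k hk hk2]
        · rw [he1]; exact le_sup_right
        · rwa [he2 _ (by omega)]
        · rw [he1]; intro h; rw [← h] at h2; exact h2 le_sup_left
      · rintro ⟨e, h5, h1, h2, h3, h4⟩
        have heq := eq_sup c d e h5.1 h1 h2 h3
        refine ⟨fun k hk hk2 => (h5.1 k hk2).trans (h1 k hk hk2), fun h => h4 ?_, fun h => h5.2 ?_⟩
        · apply flagMem2_eq_of_le
          rw [heq]; exact sup_le h (flagMem2_mono d (Nat.le_succ _))
        · apply Eq.symm
          apply flagMem2_eq_of_le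
          rw [heq]; exact sup_le (flagMem2_mono c (Nat.le_succ _)) h
    · rintro c d e e' h5 ⟨h1, h2, h3, h4⟩ h5' ⟨h1', h2', h3', h4'⟩
      refine Panel.ext (h5.1.symm.trans h5'.1) ?_
      exact (eq_sup c d e h5.1 h1 h2 h3).trans (eq_sup c d e' h5'.1 h1' h2' h3').symm

open Classical in
theorem relMatrix_panel [Fintype F] (i : ℕ) :
    relMatrix (Panel (F := F) (m := m) i) = relMatrix (Adjacent i) + 1 := by
  ext c d
  simp only [relMatrix, Matrix.add_apply, Matrix.one_apply, Adjacent]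
  by_cases h : c = d
  · subst h; simp [Panel.rfl]
  · by_cases h2 : Panel i c d
    · have h3 : flagMem2 c (i + 1) ≠ flagMem2 d (i + 1) := fun h' => h (h2.ext h')
      simp [h, h2, h3]
    · simp [h, h2]

theorem relMatrix_panel_mul_self [Fintype F] {i : ℕ} (hi : i + 1 < 2 * m) :
    relMatrix (Panel (F := F) (m := m) i) * relMatrix (Panel i) =
      ((Fintype.card F : ℂ) + 1) • relMatrix (Panel i) := by
  classical
  ext c d
  simp only [Matrix.mul_apply, relMatrix, Matrix.smul_apply, smul_eq_mul, ← ite_and, mul_ite,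
    mul_one, mul_zero]
  by_cases h : Panel i c d
  · rw [if_pos h, Finset.sum_congr rfl (g := fun e => if Panel i c e then (1 : ℂ) else 0)]
    · rw [Finset.sum_boole, card_panel c hi]; simp
    · intro e _
      exact if_congr ⟨fun h' => h'.2, fun h' => ⟨h'.symm.trans h, h'⟩⟩ rfl rfl
  · rw [if_neg h]
    exact Finset.sum_eq_zero fun e _ => if_neg fun h' => h (h'.2.trans h'.1)

/-- The generators of the Hecke algebra acting on maximal flags. -/
noncomputable def adjacentMatrix (F : Type) [Field F] (m i : ℕ) :
    Matrix (MaxFlag2 F m) (MaxFlag2 F m) ℂ :=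
  relMatrix (Adjacent i)

open Classical in
theorem heckeRel_adjacentMatrix [Fintype F] :
    HeckeRel (Fintype.card F) (2 * m - 1) (adjacentMatrix F m) where
  quad i hi := by
    rw [adjacentMatrix]
    have h1 := relMatrix_panel_mul_self (F := F) (m := m) (i := i) (by omega)
    rw [relMatrix_panel, add_mul, mul_add, one_mul, mul_one] at h1
    rw [eq_sub_of_add_eq ((add_assoc _ _ _).symm.trans h1)]
    module
  braid i hi := relMatrix_adjacent_braid (by omega)
  comm i j hij hj := by
    change relMatrix _ * relMatrix _ = relMatrix _ * relMatrix _
    rw [relMatrix_adjacent_mul_adjacent (by omega) (by omega) (by omega) (by omega),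
      relMatrix_adjacent_mul_adjacent (by omega) (by omega) (by omega) (by omega)]
    congr 1
    funext c d
    exact propext ⟨fun h => ⟨fun k hk hk2 => h.1 k hk2 hk, h.2.2, h.2.1⟩,
      fun h => ⟨fun k hk hk2 => h.1 k hk2 hk, h.2.2, h.2.1⟩⟩

end Hecke

section Opposition

variable {F : Type} [Field F] {m : ℕ}

theorem flagMem2_one_le_iff (d : MaxFlag2 F m) (hm : 1 ≤ m) (X : Submodule F (Fin (2 * m) → F)) :
    ¬ flagMem2 d 1 ≤ X ↔ X ⊓ flagMem2 d 1 = ⊥ := by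
  have h1 := finrank_flagMem2 d (by omega : 1 ≤ 2 * m)
  constructor
  · intro h
    apply Submodule.finrank_eq_zero.mp
    have h2 : X ⊓ flagMem2 d 1 < flagMem2 d 1 :=
      lt_of_le_of_ne inf_le_right fun h' => h (inf_eq_right.mp h')
    have := Submodule.finrank_lt_finrank_of_lt h2
    omega
  · intro h h'
    rw [inf_eq_right.mpr h'] at h
    rw [h, finrank_bot] at h1
    omega

theorem finrank_flagMem2_inf {c d : MaxFlag2 F m} {i k : ℕ} (hk : k + 1 ≤ 2 * m) (hi : i ≤ k)
    (h : flagMem2 c (k + 1) = flagMem2 d (k + 1)) (h1 : ¬ flagMem2 d 1 ≤ flagMem2 c k) :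
    Module.finrank F ↥(flagMem2 d (i + 1) ⊓ flagMem2 c k) = i := by
  have h2 := Submodule.finrank_sup_add_finrank_inf_eq (flagMem2 d (i + 1)) (flagMem2 c k)
  rw [finrank_flagMem2 c (by omega), finrank_flagMem2 d (by omega)] at h2
  have h3 : Module.finrank F ↥(flagMem2 d (i + 1) ⊔ flagMem2 c k) ≤ k + 1 := by
    refine (Submodule.finrank_mono ?_).trans_eq (finrank_flagMem2 c hk)
    exact sup_le (h ▸ flagMem2_mono d (by omega)) (flagMem2_mono c (by omega))
  have h4 : k < Module.finrank F ↥(flagMem2 d (i + 1) ⊔ flagMem2 c k) := by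
    refine (finrank_flagMem2 c (by omega)).symm.trans_lt (Submodule.finrank_lt_finrank_of_lt ?_)
    refine lt_of_le_of_ne le_sup_right fun h' => h1 ?_
    exact (flagMem2_mono d (by omega)).trans (right_eq_sup.mp h')
  omega

/-- The relative position of flags given by the word `k - 1, …, 0`. -/
def CoxeterPos (k : ℕ) (c d : MaxFlag2 F m) : Prop :=
  (∀ j, k < j → flagMem2 c j = flagMem2 d j) ∧ ¬ flagMem2 d 1 ≤ flagMem2 c k ∧
    ∀ i < k, flagMem2 c i ≤ flagMem2 d (i + 1)

/-- Two flags agree in dimension at least `k` and are opposite below. -/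
def OppBelow (k : ℕ) (c d : MaxFlag2 F m) : Prop :=
  (∀ j, k ≤ j → flagMem2 c j = flagMem2 d j) ∧
    ∀ i ≤ k, flagMem2 c i ⊓ flagMem2 d (k - i) = ⊥

theorem OppBelow.symm {k : ℕ} {c d : MaxFlag2 F m} (h : OppBelow k c d) : OppBelow k d c := by
  refine ⟨fun j hj => (h.1 j hj).symm, fun i hi => ?_⟩
  rw [inf_comm]
  simpa [Nat.sub_sub_self hi] using h.2 (k - i) (by omega)

theorem oppBelow_iff_opp2 {c d : MaxFlag2 F m} : OppBelow (2 * m) c d ↔ Opp2 c d := by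
  have hrev : ∀ i : Fin (2 * m + 1), i.rev = ⟨2 * m - i, by omega⟩ :=
    fun i => Fin.ext (by simp only [Fin.val_rev]; omega)
  constructor
  · intro h i
    have := h.2 i (by omega)
    rw [flagMem2_of_le c (by omega), flagMem2_of_le d (by omega)] at this
    rw [hrev i]
    exact this
  · intro h
    refine ⟨fun j hj => by rw [flagMem2_eq_top c hj, flagMem2_eq_top d hj], fun i hi => ?_⟩
    have := h ⟨i, by omega⟩
    rw [hrev] at this
    rw [flagMem2_of_le c hi, flagMem2_of_le d (by omega)]
    exact this

open Classical in
theorem coxeterProd_adjacentMatrix [Fintype F] (hm : 1 ≤ m) {k : ℕ} (hk : k < 2 * m) :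
    coxeterProd (adjacentMatrix F m) k = relMatrix (CoxeterPos k) := by
  induction k with
  | zero =>
    refine (relMatrix_eq_one fun c d => ⟨fun h => ext_flagMem2 fun j => ?_, ?_⟩).symm
    · rcases Nat.eq_zero_or_pos j with rfl | hj
      · rw [flagMem2_zero, flagMem2_zero]
      · exact h.1 j hj
    · rintro rfl
      refine ⟨fun _ _ => rfl, ?_, fun i hi => absurd hi (Nat.not_lt_zero i)⟩
      rw [flagMem2_one_le_iff c hm, flagMem2_zero, bot_inf_eq]
  | succ k ih =>
    rw [coxeterProd, ih (by omega), adjacentMatrix]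
    apply relMatrix_mul
    · intro c d
      constructor
      · rintro ⟨h1, h2, h3⟩
        obtain ⟨e, he1, he2⟩ := exists_update c hk (h3 k (by omega))
          (h1 (k + 2) (by omega) ▸ flagMem2_mono d (by omega)) (finrank_flagMem2 d (by omega))
        refine ⟨e, ⟨fun j hj => (he2 j hj).symm, ?_⟩, fun j hj => ?_, ?_, fun i hi => ?_⟩
        · rw [he1]; intro h; rw [h] at h2; exact h2 (flagMem2_mono d (by omega))
        · rcases eq_or_ne j (k + 1) with rfl | hne
          · exact he1
          · rw [he2 j hne, h1 j (by omega)]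
        · rw [he2 k (by omega)]
          exact fun h => h2 (h.trans (flagMem2_mono c (by omega)))
        · rw [he2 i (by omega)]
          exact h3 i (by omega)
      · rintro ⟨e, ⟨h1, h2⟩, h3, h4, h5⟩
        refine ⟨fun j hj => (h1 j (by omega)).trans (h3 j (by omega)), fun h => ?_, fun i hi => ?_⟩
        · rw [h3 (k + 1) (by omega)] at h2
          have hne := inf_eq_right.mpr (le_inf h (flagMem2_mono d (by omega) :
            flagMem2 d 1 ≤ flagMem2 d (k + 1)))
          have hle : flagMem2 c k ≤ flagMem2 d (k + 1) := by
            rw [h1 k (by omega), ← h3 (k + 1) (by omega)]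
            exact flagMem2_mono e (by omega)
          rw [← h1 k (by omega)] at h4
          apply h4
          have h6 : flagMem2 c k = flagMem2 c (k + 1) ⊓ flagMem2 d (k + 1) := by
            apply Submodule.eq_of_le_of_finrank_le (le_inf (flagMem2_mono c (by omega)) hle)
            rw [finrank_flagMem2 c (by omega)]
            have : Module.finrank F ↥(flagMem2 c (k + 1) ⊓ flagMem2 d (k + 1)) < k + 1 := by
              refine (Submodule.finrank_lt_finrank_of_lt (t := flagMem2 c (k + 1)) ?_).trans_eq
                (finrank_flagMem2 c (by omega))
              refine lt_of_le_of_ne inf_le_left fun h' => h2 ?_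
              exact flagMem2_eq_of_le c d (inf_eq_left.mp h')
            omega
          rw [h6]
          exact le_inf h (flagMem2_mono d (by omega))
        · rcases Nat.lt_succ_iff_lt_or_eq.mp hi with hlt | rfl
          · rw [h1 i (by omega)]; exact h5 i hlt
          · rw [h1 i (by omega), ← h3 (i + 1) (by omega)]
            exact flagMem2_mono e (by omega)
    · intro c d e e' h1 h2 h3 h4
      exact (h1.1.symm.trans h3.1).ext ((h2.1 _ (by omega)).trans (h4.1 _ (by omega)).symm)

open Classical in
theorem longestProd_adjacentMatrix [Fintype F] (hm : 1 ≤ m) {k : ℕ} (hk : k ≤ 2 * m) :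
    longestProd (adjacentMatrix F m) k = relMatrix (OppBelow k) := by
  induction k with
  | zero =>
    refine (relMatrix_eq_one fun c d =>
      ⟨fun h => ext_flagMem2 fun j => h.1 j (Nat.zero_le _), ?_⟩).symm
    rintro rfl
    refine ⟨fun _ _ => rfl, fun i hi => ?_⟩
    rw [Nat.le_zero.mp hi, flagMem2_zero, bot_inf_eq]
  | succ k ih =>
    rw [longestProd, ih (by omega), coxeterProd_adjacentMatrix hm hk]
    have eq_inf : ∀ c d e : MaxFlag2 F m, (∀ j, k ≤ j → flagMem2 c j = flagMem2 e j) →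
        ¬ flagMem2 d 1 ≤ flagMem2 c k → (∀ i < k, flagMem2 e i ≤ flagMem2 d (i + 1)) →
        flagMem2 c (k + 1) = flagMem2 d (k + 1) →
        ∀ i < k, flagMem2 e i = flagMem2 d (i + 1) ⊓ flagMem2 c k := by
      intro c d e h1 h4 h5 hck i hi
      apply Submodule.eq_of_le_of_finrank_le
      · exact le_inf (h5 i hi) (h1 k le_rfl ▸ flagMem2_mono e hi.le)
      · rw [finrank_flagMem2_inf hk hi.le hck h4, finrank_flagMem2 e (by omega)]
    apply relMatrix_mul
    · intro c d
      constructor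
      · rintro ⟨h1, h2⟩
        have hd : ¬ flagMem2 d 1 ≤ flagMem2 c k := by
          rw [flagMem2_one_le_iff d hm]
          simpa using h2 k (by omega)
        have hr : ∀ i ≤ k, Module.finrank F ↥(flagMem2 d (i + 1) ⊓ flagMem2 c k) = i :=
          fun i hi => finrank_flagMem2_inf hk hi (h1 _ le_rfl) hd
        obtain ⟨e, he⟩ := exists_flagMem2_eq
          (fun i => if i < k then flagMem2 d (i + 1) ⊓ flagMem2 c k else flagMem2 c i)
          (fun i hi => by
            by_cases hik : i < k
            · rw [if_pos hik]
              by_cases hik2 : i + 1 < k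
              · rw [if_pos hik2]; exact inf_le_inf_right _ (flagMem2_mono d (by omega))
              · rw [if_neg hik2]; exact inf_le_right.trans (flagMem2_mono c (by omega))
            · rw [if_neg hik, if_neg (by omega)]; exact flagMem2_mono c (by omega))
          (fun i hi => by
            by_cases hik : i < k
            · rw [if_pos hik]; exact hr i hik.le
            · rw [if_neg hik]; exact finrank_flagMem2 c hi)
        have he1 : ∀ j, k ≤ j → flagMem2 e j = flagMem2 c j := by
          intro j hj
          by_cases hj2 : j ≤ 2 * m
          · rw [he j hj2, if_neg (by omega)]
          · rw [flagMem2_eq_top e (by omega), flagMem2_eq_top c (by omega)]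
        have he2 : ∀ i < k, flagMem2 e i = flagMem2 d (i + 1) ⊓ flagMem2 c k := by
          intro i hi
          rw [he i (by omega), if_pos hi]
        refine ⟨e, ⟨fun j hj => (he1 j hj).symm, fun i hi => ?_⟩, fun j hj => ?_, ?_,
          fun i hi => ?_⟩
        · rcases Nat.eq_zero_or_pos i with rfl | hi0
          · rw [flagMem2_zero, bot_inf_eq]
          · rw [he2 _ (by omega), eq_bot_iff, ← h2 i (by omega),
              show k - i + 1 = k + 1 - i by omega]
            exact inf_le_inf_left _ inf_le_left
        · rw [he1 j (by omega), h1 j (by omega)]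
        · rwa [he1 k le_rfl]
        · rw [he2 i hi]; exact inf_le_left
      · rintro ⟨e, ⟨h1, h2⟩, h3, h4, h5⟩
        rw [← h1 k le_rfl] at h4
        refine ⟨fun j hj => (h1 j (by omega)).trans (h3 j (by omega)), fun i hi => ?_⟩
        have hck : flagMem2 c (k + 1) = flagMem2 d (k + 1) :=
          (h1 _ (by omega)).trans (h3 _ (by omega))
        rcases Nat.eq_zero_or_pos i with rfl | hi0
        · rw [flagMem2_zero, bot_inf_eq]
        · rcases hi.eq_or_lt with rfl | hlt
          · rw [Nat.sub_self, flagMem2_zero, inf_bot_eq]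
          · have h6 := eq_inf c d e h1 h4 h5 hck (k - i) (by omega)
            rw [eq_bot_iff, ← h2 i (by omega), h6, show k - i + 1 = k + 1 - i by omega]
            exact le_inf inf_le_left (le_inf inf_le_right
              (inf_le_left.trans (flagMem2_mono c (by omega))))
    · rintro c d e e' ⟨h1, h2⟩ ⟨h3, h4, h5⟩ ⟨h1', h2'⟩ ⟨h3', h4', h5'⟩
      rw [← h1 k le_rfl] at h4
      have hck : flagMem2 c (k + 1) = flagMem2 d (k + 1) :=
        (h1 _ (by omega)).trans (h3 _ (by omega))
      refine ext_flagMem2 fun j => ?_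
      by_cases hj : k ≤ j
      · rw [← h1 j hj, h1' j hj]
      · rw [eq_inf c d e h1 h4 h5 hck j (by omega), eq_inf c d e' h1' h4 h5' hck j (by omega)]

theorem transpose_adjacentMatrix (i : ℕ) : (adjacentMatrix F m i)ᵀ = adjacentMatrix F m i :=
  relMatrix_transpose fun _ _ => Adjacent.symm

open Classical in
theorem adj2_eq_longestProd [Fintype F] (hm : 1 ≤ m) :
    adj2 F m = longestProd (adjacentMatrix F m) (2 * m) := by
  rw [longestProd_adjacentMatrix hm le_rfl]
  ext c d
  simp only [adj2, relMatrix, oppBelow_iff_opp2]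

open Classical in
theorem adj2_mul_self [Fintype F] (hm : 1 ≤ m) :
    adj2 F m * adj2 F m = jucysMurphyProd (adjacentMatrix F m) (2 * m - 1) := by
  have h := heckeRel_adjacentMatrix (F := F) (m := m)
  rw [adj2_eq_longestProd hm, ← h.longestProd_sq (fun i _ => transpose_adjacentMatrix i) le_rfl,
    Nat.sub_add_cancel (by omega)]
  intro k hk
  rw [longestProd_adjacentMatrix hm (by omega)]
  exact relMatrix_transpose fun _ _ => OppBelow.symm

end Opposition

section Incidence

variable {F : Type} [Field F] {m : ℕ}

open Classical in
/-- The indicator function of the flags whose `k`-dimensional part contains `x`. -/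
noncomputable def memVec (x : Fin (2 * m) → F) (k : ℕ) (c : MaxFlag2 F m) : ℂ :=
  if x ∈ flagMem2 c k then 1 else 0

theorem memVec_zero {x : Fin (2 * m) → F} (hx : x ≠ 0) : memVec x 0 = 0 := by
  funext c
  rw [memVec, if_neg, Pi.zero_apply]
  rwa [flagMem2_zero, Submodule.mem_bot]

theorem memVec_of_le {x : Fin (2 * m) → F} {k : ℕ} (hk : 2 * m ≤ k) : memVec x k = 1 := by
  funext c
  rw [memVec, if_pos, Pi.one_apply]
  rw [flagMem2_eq_top c hk]
  exact Submodule.mem_top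

theorem exists_eq_span_singleton {P : Submodule F (Fin (2 * m) → F)}
    (hP : Module.finrank F P = 1) : ∃ x, x ≠ 0 ∧ P = Submodule.span F {x} := by
  obtain ⟨x, hx, hx0⟩ := P.exists_mem_ne_zero_of_ne_bot (by rintro rfl; simp at hP)
  refine ⟨x, hx0, (Submodule.eq_of_le_of_finrank_le ?_ ?_).symm⟩
  · rwa [Submodule.span_singleton_le_iff_mem]
  · rw [hP, finrank_span_singleton hx0]

variable [Fintype F]

open Classical in
theorem relMatrix_panel_mulVec_apply (i : ℕ) (v : MaxFlag2 F m → ℂ) (c : MaxFlag2 F m) :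
    (relMatrix (Panel i) *ᵥ v) c = ∑ e with Panel i c e, v e := by
  simp [Matrix.mulVec, dotProduct, relMatrix, Finset.sum_filter]

open Classical in
theorem adjacentMatrix_mulVec (i : ℕ) (v : MaxFlag2 F m → ℂ) :
    adjacentMatrix F m i *ᵥ v = relMatrix (Panel i) *ᵥ v - v := by
  rw [relMatrix_panel, Matrix.add_mulVec, Matrix.one_mulVec, add_sub_cancel_right, adjacentMatrix]

theorem adjacentMatrix_mulVec_memVec_of_ne {i k : ℕ} (hi : i + 1 < 2 * m) (hk : k ≠ i + 1)
    (x : Fin (2 * m) → F) :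
    adjacentMatrix F m i *ᵥ memVec x k = (Fintype.card F : ℂ) • memVec x k := by
  classical
  rw [adjacentMatrix_mulVec]
  funext c
  rw [Pi.sub_apply, relMatrix_panel_mulVec_apply,
    Finset.sum_congr rfl (g := fun _ => memVec x k c), Finset.sum_const, card_panel c hi]
  · simp [add_mul]
  · intro e he
    rw [memVec, memVec, (Finset.mem_filter.mp he).2 k hk]

theorem adjacentMatrix_mulVec_memVec {i : ℕ} (hi : i + 1 < 2 * m) (x : Fin (2 * m) → F) :
    adjacentMatrix F m i *ᵥ memVec x (i + 1) =
      (Fintype.card F : ℂ) • memVec x i + memVec x (i + 2) - memVec x (i + 1) := by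
  classical
  rw [adjacentMatrix_mulVec]
  congr 1
  funext c
  rw [relMatrix_panel_mulVec_apply, Pi.add_apply, Pi.smul_apply, smul_eq_mul]
  by_cases h1 : x ∈ flagMem2 c i
  · rw [Finset.sum_congr rfl (g := fun _ => (1 : ℂ)), Finset.sum_const, card_panel c hi]
    · simp [memVec, h1, flagMem2_mono c (by omega : i ≤ i + 2) h1]
    · intro e he
      rw [memVec, if_pos]
      rw [(Finset.mem_filter.mp he).2 i (by omega)] at h1
      exact flagMem2_mono e (Nat.le_succ i) h1
  · by_cases h2 : x ∈ flagMem2 c (i + 2)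
    · obtain ⟨e, he1, he2⟩ := exists_panel_mem c hi h1 h2
      rw [Finset.sum_eq_single e]
      · simp [memVec, h1, h2, he2]
      · intro e' he' hne
        rw [memVec, if_neg]
        exact fun h => hne ((Finset.mem_filter.mp he').2.eq_of_mem hi he1 h1 h he2)
      · intro h
        exact absurd (Finset.mem_filter.mpr ⟨Finset.mem_univ e, he1⟩) h
    · rw [Finset.sum_eq_zero]
      · simp [memVec, h1, h2]
      · intro e he
        rw [memVec, if_neg]
        intro h
        apply h2
        rw [(Finset.mem_filter.mp he).2 (i + 2) (by omega)]
        exact flagMem2_mono e (Nat.le_succ _) h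

open Classical in
theorem coxeterProd_mulVec_memVec_of_lt {k i : ℕ} (hk : k < 2 * m) (hi : k < i)
    (x : Fin (2 * m) → F) :
    coxeterProd (adjacentMatrix F m) k *ᵥ memVec x i = (Fintype.card F : ℂ) ^ k • memVec x i := by
  induction k with
  | zero => simp [coxeterProd]
  | succ k ih =>
    rw [coxeterProd, ← Matrix.mulVec_mulVec, ih (by omega) (by omega), Matrix.mulVec_smul,
      adjacentMatrix_mulVec_memVec_of_ne hk (by omega), smul_smul, pow_succ]

open Classical in
theorem coxeterProd_mulVec_memVec {k i : ℕ} (hk : k < 2 * m) (hi : i ≤ k)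
    (x : Fin (2 * m) → F) :
    coxeterProd (adjacentMatrix F m) k *ᵥ memVec x (i + 1) =
      (Fintype.card F : ℂ) ^ k • memVec x i +
        (Fintype.card F : ℂ) ^ i • (memVec x (k + 1) - memVec x k) := by
  induction k with
  | zero =>
    rw [Nat.le_zero.mp hi]
    simp [coxeterProd]
  | succ k ih =>
    rcases hi.eq_or_lt with rfl | hlt
    · rw [coxeterProd_mulVec_memVec_of_lt hk (Nat.lt_succ_self _)]
      module
    · rw [coxeterProd, ← Matrix.mulVec_mulVec, ih (by omega) (by omega), Matrix.mulVec_add,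
        Matrix.mulVec_smul, Matrix.mulVec_smul, Matrix.mulVec_sub,
        adjacentMatrix_mulVec_memVec_of_ne hk (by omega : i ≠ k + 1),
        adjacentMatrix_mulVec_memVec_of_ne hk (by omega : k ≠ k + 1),
        adjacentMatrix_mulVec_memVec hk]
      module

open Classical in
theorem longestProd_mulVec_memVec_of_le {k i : ℕ} (hk : k ≤ 2 * m) (hi : k ≤ i)
    (x : Fin (2 * m) → F) :
    longestProd (adjacentMatrix F m) k *ᵥ memVec x i =
      (Fintype.card F : ℂ) ^ k.choose 2 • memVec x i := by
  induction k with
  | zero => simp [longestProd]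
  | succ k ih =>
    rw [longestProd, ← Matrix.mulVec_mulVec, coxeterProd_mulVec_memVec_of_lt hk hi,
      Matrix.mulVec_smul, ih (by omega) (by omega), smul_smul, ← pow_add,
      Nat.choose_succ_succ' k 1, Nat.choose_one_right]

open Classical in
theorem longestProd_mulVec_memVec {k i : ℕ} (hk : k ≤ 2 * m) (hi : i ≤ k)
    {x : Fin (2 * m) → F} (hx : x ≠ 0) :
    (Fintype.card F : ℂ) ^ k • (longestProd (adjacentMatrix F m) k *ᵥ memVec x i) =
      (Fintype.card F : ℂ) ^ (k.choose 2 + i) • (memVec x k - memVec x (k - i)) := by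
  induction k generalizing i with
  | zero =>
    rw [Nat.le_zero.mp hi]
    simp [memVec_zero hx]
  | succ k ih =>
    cases i with
    | zero => simp [memVec_zero hx]
    | succ i =>
      rw [longestProd, ← Matrix.mulVec_mulVec, coxeterProd_mulVec_memVec hk (by omega),
        Matrix.mulVec_add, Matrix.mulVec_smul, Matrix.mulVec_smul, Matrix.mulVec_sub,
        longestProd_mulVec_memVec_of_le (by omega) (Nat.le_succ k),
        longestProd_mulVec_memVec_of_le (by omega) le_rfl, pow_succ', mul_smul, smul_add,
        ih (by omega) (by omega), Nat.choose_succ_succ' k 1, Nat.choose_one_right,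
        Nat.add_sub_add_right]
      module

end Incidence

section Eigen

variable {F : Type} [Field F] [Fintype F] {m : ℕ}

theorem choose_two_mul_two (hm : 1 ≤ m) : (2 * m).choose 2 = 2 * m ^ 2 - 2 * m + m := by
  obtain ⟨k, rfl⟩ := Nat.exists_eq_add_of_le' hm
  rw [Nat.choose_two_right, mul_assoc, Nat.mul_div_cancel_left _ two_pos,
    show 2 * (k + 1) ^ 2 = 2 * (k + 1) + 2 * k * (k + 1) by ring, Nat.add_sub_cancel_left,
    show 2 * (k + 1) - 1 = 2 * k + 1 by omega]
  ring

theorem adj2_mulVec_memVec_add {x : Fin (2 * m) → F} (hx : x ≠ 0) (hm : 1 ≤ m) {i : ℕ}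
    (hi : i ≤ m) :
    adj2 F m *ᵥ memVec x (m + i) =
      ((Fintype.card F : ℂ) ^ (2 * m ^ 2 - 2 * m) * (Fintype.card F : ℂ) ^ i) •
        (1 - memVec x (m - i)) := by
  classical
  have hq : (Fintype.card F : ℂ) ≠ 0 := Nat.cast_ne_zero.mpr Fintype.card_ne_zero
  have h := longestProd_mulVec_memVec (i := m + i) le_rfl (by omega) hx
  rw [← adj2_eq_longestProd hm, memVec_of_le le_rfl, show 2 * m - (m + i) = m - i by omega] at h
  apply smul_right_injective _ (pow_ne_zero (2 * m) hq)
  simp only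
  rw [h, smul_smul, ← pow_add, ← pow_add]
  congr 2
  rw [choose_two_mul_two hm]
  omega

theorem adj2_mulVec_memVec_sub {x : Fin (2 * m) → F} (hx : x ≠ 0) (hm : 1 ≤ m) {i : ℕ}
    (hi : i ≤ m) :
    (Fintype.card F : ℂ) ^ i • (adj2 F m *ᵥ memVec x (m - i)) =
      (Fintype.card F : ℂ) ^ (2 * m ^ 2 - 2 * m) • (1 - memVec x (m + i)) := by
  classical
  have hq : (Fintype.card F : ℂ) ≠ 0 := Nat.cast_ne_zero.mpr Fintype.card_ne_zero
  have h := longestProd_mulVec_memVec (i := m - i) le_rfl (by omega) hx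
  rw [← adj2_eq_longestProd hm, memVec_of_le le_rfl, show 2 * m - (m - i) = m + i by omega] at h
  apply smul_right_injective _ (pow_ne_zero (2 * m) hq)
  simp only
  rw [smul_comm, h, smul_smul, smul_smul, ← pow_add, ← pow_add]
  congr 2
  rw [choose_two_mul_two hm]
  omega

theorem chi2_span_singleton (x : Fin (2 * m) → F) (j : ℕ) :
    chi2 F m j (Submodule.span F {x}) =
      ((Fintype.card F : ℂ) ^ j + 1) • memVec x m - (Fintype.card F : ℂ) ^ j • memVec x (m - j) -
        memVec x (m + j) := by
  funext c
  simp only [chi2, memVec, Submodule.span_singleton_le_iff_mem, Pi.sub_apply, Pi.smul_apply,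
    smul_eq_mul]
  by_cases h1 : x ∈ flagMem2 c (m - j)
  · have h2 := flagMem2_mono c (by omega : m - j ≤ m) h1
    have h3 := flagMem2_mono c (by omega : m ≤ m + j) h2
    simp [h1, h2, h3]
  · by_cases h2 : x ∈ flagMem2 c m
    · have h3 := flagMem2_mono c (by omega : m ≤ m + j) h2
      simp [h1, h2, h3]
    · by_cases h3 : x ∈ flagMem2 c (m + j) <;> simp [h1, h2, h3]

theorem adj2_mulVec_chi2 (hm : 1 ≤ m) {j : ℕ} (hj : j ≤ m)
    {P : Submodule F (Fin (2 * m) → F)} (hP : Module.finrank F P = 1) :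
    adj2 F m *ᵥ chi2 F m j P =
      (-((Fintype.card F : ℂ) ^ (2 * m ^ 2 - 2 * m))) • chi2 F m j P := by
  obtain ⟨x, hx, rfl⟩ := exists_eq_span_singleton hP
  have h0 := adj2_mulVec_memVec_add hx hm (Nat.zero_le m)
  rw [add_zero, Nat.sub_zero, pow_zero, mul_one] at h0
  rw [chi2_span_singleton, Matrix.mulVec_sub, Matrix.mulVec_sub, Matrix.mulVec_smul,
    Matrix.mulVec_smul, h0, adj2_mulVec_memVec_add hx hm hj, adj2_mulVec_memVec_sub hx hm hj]
  module

end Eigen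

section Hyperplane

variable {F : Type} [Field F] {m : ℕ}

theorem exists_chain (X : Submodule F (Fin (2 * m) → F)) {s : ℕ} (hs : s ≤ Module.finrank F X) :
    ∃ g : ℕ → Submodule F (Fin (2 * m) → F), (∀ j < s, g j ≤ g (j + 1)) ∧
      ∀ j ≤ s, Module.finrank F (g j) = j ∧ g j ≤ X := by
  induction s with
  | zero =>
    refine ⟨fun _ => ⊥, fun j hj => absurd hj (Nat.not_lt_zero j), fun j hj => ?_⟩
    rw [Nat.le_zero.mp hj]
    exact ⟨finrank_bot F _, bot_le⟩
  | succ s ih =>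
    obtain ⟨g, hg1, hg2⟩ := ih (by omega)
    have hlt : g s < X := by
      refine lt_of_le_of_ne (hg2 s le_rfl).2 fun h => ?_
      have := (hg2 s le_rfl).1
      rw [h] at this
      omega
    obtain ⟨x, hx, hxg⟩ := SetLike.exists_of_lt hlt
    refine ⟨Function.update g (s + 1) (g s ⊔ Submodule.span F {x}), fun j hj => ?_, fun j hj => ?_⟩
    · rw [Function.update_of_ne (by omega)]
      rcases Nat.lt_succ_iff_lt_or_eq.mp hj with hj' | rfl
      · rw [Function.update_of_ne (by omega)]; exact hg1 j hj'
      · rw [Function.update_self]; exact le_sup_left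
    · rcases hj.eq_or_lt with rfl | hj'
      · rw [Function.update_self, Submodule.finrank_sup_span_singleton hxg, (hg2 s le_rfl).1]
        exact ⟨rfl, sup_le hlt.le ((Submodule.span_singleton_le_iff_mem _ _).mpr hx)⟩
      · rw [Function.update_of_ne (by omega)]; exact hg2 j (by omega)

/-- A function constant on panels only depends on the parts of the flag of large dimension. -/
theorem apply_eq_of_panel {α : Type*} (v : MaxFlag2 F m → α) {k : ℕ} (hk : k ≤ 2 * m)
    (hv : ∀ i, i + 1 < k → ∀ c d, Panel i c d → v c = v d) (c d : MaxFlag2 F m)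
    (h : ∀ j, k ≤ j → flagMem2 c j = flagMem2 d j) : v c = v d := by
  induction k generalizing c d with
  | zero => rw [ext_flagMem2 fun j => h j (Nat.zero_le j)]
  | succ k ih =>
    have ih' := ih (by omega) (fun i _ => hv i (by omega))
    by_cases hck : flagMem2 c k = flagMem2 d k
    · refine ih' c d fun j hj => ?_
      rcases hj.eq_or_lt with rfl | hj'
      · exact hck
      · exact h j hj'
    · obtain _ | k := k
      · exact absurd ((flagMem2_zero c).trans (flagMem2_zero d).symm) hck
      have hX := finrank_inf_of_ne c d hk (h _ le_rfl) hck
      obtain ⟨g, hg1, hg2⟩ := exists_chain _ hX.ge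
      have hgk := Submodule.eq_of_le_of_finrank_le (hg2 k le_rfl).2
        (hX.trans (hg2 k le_rfl).1.symm).le
      obtain ⟨e, he⟩ := exists_flagMem2_eq (fun i => if i ≤ k then g i else flagMem2 c i)
        (fun i hi => by
          by_cases hik : i ≤ k
          · rw [if_pos hik]
            rcases hik.eq_or_lt with rfl | hlt
            · rw [if_neg (by omega), hgk]; exact inf_le_left
            · rw [if_pos (by omega)]; exact hg1 i hlt
          · rw [if_neg hik, if_neg (by omega)]; exact flagMem2_mono c (Nat.le_succ i))
        (fun i hi => by
          by_cases hik : i ≤ k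
          · rw [if_pos hik]; exact (hg2 i hik).1
          · rw [if_neg hik]; exact finrank_flagMem2 c hi)
      have hce : ∀ j, k + 1 ≤ j → flagMem2 c j = flagMem2 e j := by
        intro j hj
        by_cases hj2 : j ≤ 2 * m
        · rw [he j hj2, if_neg (by omega)]
        · rw [flagMem2_eq_top e (by omega), flagMem2_eq_top c (by omega)]
      obtain ⟨e', he1, he2⟩ := exists_update e (i := k) (by omega) (X := flagMem2 d (k + 1))
        (by rw [he k (by omega), if_pos le_rfl, hgk]; exact inf_le_right)
        (by rw [← hce (k + 2) (by omega), h (k + 2) le_rfl]; exact flagMem2_mono d (by omega))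
        (finrank_flagMem2 d (by omega))
      rw [ih' c e hce, hv k (by omega) e e' fun j hj => (he2 j hj).symm]
      refine ih' e' d fun j hj => ?_
      rcases hj.eq_or_lt with rfl | hj'
      · exact he1
      · rw [he2 j (by omega), ← hce j (by omega), h j (by omega)]

/-- The span of the functions `memVec x k` with `x` nonzero. -/
def memSpan (F : Type) [Field F] (m : ℕ) : Submodule ℂ (MaxFlag2 F m → ℂ) :=
  Submodule.span ℂ {f | ∃ x k, x ≠ 0 ∧ k ≤ 2 * m ∧ f = memVec x k}

theorem memVec_mem_memSpan {x : Fin (2 * m) → F} (hx : x ≠ 0) {k : ℕ} (hk : k ≤ 2 * m) :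
    memVec x k ∈ memSpan F m := Submodule.subset_span ⟨x, k, hx, hk, rfl⟩

theorem one_mem_memSpan (hm : 1 ≤ m) : (1 : MaxFlag2 F m → ℂ) ∈ memSpan F m := by
  have : Nonempty (Fin (2 * m)) := ⟨⟨0, by omega⟩⟩
  obtain ⟨x, hx⟩ := exists_ne (0 : Fin (2 * m) → F)
  rw [← memVec_of_le (x := x) le_rfl]
  exact memVec_mem_memSpan hx le_rfl

variable [Fintype F]

theorem apply_eq_of_panel_of_mulVec_eq {i : ℕ} {v : MaxFlag2 F m → ℂ}
    (hv : adjacentMatrix F m i *ᵥ v = (Fintype.card F : ℂ) • v) {c d : MaxFlag2 F m}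
    (h : Panel i c d) : v c = v d := by
  classical
  rw [adjacentMatrix_mulVec, sub_eq_iff_eq_add] at hv
  have key : ∀ c, ∑ e with Panel i c e, v e = ((Fintype.card F : ℂ) + 1) * v c := by
    intro c
    rw [← relMatrix_panel_mulVec_apply, hv]
    simp [add_mul]
  have h1 : ((Fintype.card F : ℂ) + 1) ≠ 0 := Nat.cast_add_one_ne_zero _
  apply mul_left_cancel₀ h1
  rw [← key, ← key]
  congr 1
  ext e
  simp only [Finset.mem_filter, Finset.mem_univ, true_and]
  exact ⟨h.symm.trans, h.trans⟩

theorem adjacentMatrix_mulVec_mem_memSpan {i : ℕ} (hi : i + 1 < 2 * m) {v : MaxFlag2 F m → ℂ}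
    (hv : v ∈ memSpan F m) : adjacentMatrix F m i *ᵥ v ∈ memSpan F m := by
  have h : memSpan F m ≤ (memSpan F m).comap (adjacentMatrix F m i).mulVecLin := by
    refine Submodule.span_le.mpr ?_
    rintro _ ⟨x, k, hx, hk, rfl⟩
    rw [SetLike.mem_coe, Submodule.mem_comap, Matrix.mulVecLin_apply]
    rcases eq_or_ne k (i + 1) with rfl | hne
    · rw [adjacentMatrix_mulVec_memVec hi]
      exact Submodule.sub_mem _ (Submodule.add_mem _
        (Submodule.smul_mem _ _ (memVec_mem_memSpan hx (by omega)))
        (memVec_mem_memSpan hx (by omega))) (memVec_mem_memSpan hx hk)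
    · rw [adjacentMatrix_mulVec_memVec_of_ne hi hne]
      exact Submodule.smul_mem _ _ (memVec_mem_memSpan hx hk)
  exact h hv

open Classical in
theorem hyperplane_indicator_mem_memSpan (hm : 1 ≤ m) (c : MaxFlag2 F m) :
    (fun d => if flagMem2 c (2 * m - 1) = flagMem2 d (2 * m - 1) then (1 : ℂ) else 0) ∈
      memSpan F m := by
  obtain ⟨p, hp⟩ : ∃ p, 2 * m = p + 2 := ⟨2 * m - 2, by omega⟩
  rw [show 2 * m - 1 = p + 1 by omega]
  have hq : (Fintype.card F : ℂ) ≠ 0 := Nat.cast_ne_zero.mpr Fintype.card_ne_zero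
  have hq1 : (Fintype.card F : ℂ) - 1 ≠ 0 := by
    rw [sub_ne_zero]
    exact_mod_cast (Fintype.one_lt_card (α := F)).ne'
  have hsum : ∀ d : MaxFlag2 F m,
      ∑ x with x ∈ flagMem2 c (p + 1) ∧ x ≠ 0, memVec x (p + 1) d =
        (Fintype.card F : ℂ) ^ Module.finrank F ↥(flagMem2 c (p + 1) ⊓ flagMem2 d (p + 1)) - 1 := by
    intro d
    simp only [memVec]
    rw [Finset.sum_boole, Finset.filter_filter]
    have h1 : (Finset.univ.filter fun x : Fin (2 * m) → F =>
        (x ∈ flagMem2 c (p + 1) ∧ x ≠ 0) ∧ x ∈ flagMem2 d (p + 1)) =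
        (Finset.univ.filter fun x => x ∈ flagMem2 c (p + 1) ⊓ flagMem2 d (p + 1)).erase 0 := by
      ext x
      simp only [Finset.mem_filter, Finset.mem_univ, true_and, Finset.mem_erase,
        Submodule.mem_inf]
      tauto
    have h2 : (Finset.univ.filter fun x : Fin (2 * m) → F =>
        x ∈ flagMem2 c (p + 1) ⊓ flagMem2 d (p + 1)).card =
        Fintype.card F ^ Module.finrank F ↥(flagMem2 c (p + 1) ⊓ flagMem2 d (p + 1)) := by
      rw [← Nat.card_eq_fintype_card (α := F), ← Module.natCard_eq_pow_finrank,
        Nat.card_eq_fintype_card, Fintype.card_subtype]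
    rw [h1, Finset.card_erase_of_mem (by simp), h2, Nat.cast_sub (Nat.one_le_pow _ _
      Fintype.card_pos)]
    simp
  have heq : (fun d => if flagMem2 c (p + 1) = flagMem2 d (p + 1) then (1 : ℂ) else 0) =
      ((Fintype.card F : ℂ) ^ p * ((Fintype.card F : ℂ) - 1))⁻¹ •
        (∑ x with x ∈ flagMem2 c (p + 1) ∧ x ≠ 0, memVec x (p + 1) -
          ((Fintype.card F : ℂ) ^ p - 1) • (1 : MaxFlag2 F m → ℂ)) := by
    funext d
    rw [Pi.smul_apply, Pi.sub_apply, Finset.sum_apply, hsum, Pi.smul_apply, Pi.one_apply,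
      smul_eq_mul, smul_eq_mul, mul_one, eq_inv_mul_iff_mul_eq₀
        (mul_ne_zero (pow_ne_zero p hq) hq1)]
    split_ifs with h
    · rw [h, inf_idem, finrank_flagMem2 d (by omega)]
      ring
    · rw [finrank_inf_of_ne c d (by omega) _ h]
      · ring
      · rw [flagMem2_eq_top c (by omega), flagMem2_eq_top d (by omega)]
  rw [heq]
  refine Submodule.smul_mem _ _ (Submodule.sub_mem _ (Submodule.sum_mem _ fun x hx => ?_)
    (Submodule.smul_mem _ _ (one_mem_memSpan hm)))
  exact memVec_mem_memSpan (Finset.mem_filter.mp hx).2.2 (by omega)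

theorem mem_memSpan_of_trivial (hm : 1 ≤ m) {v : MaxFlag2 F m → ℂ}
    (hv : ∀ i < 2 * m - 2, adjacentMatrix F m i *ᵥ v = (Fintype.card F : ℂ) • v) :
    v ∈ memSpan F m := by
  classical
  have h1 : ∀ c d : MaxFlag2 F m, flagMem2 c (2 * m - 1) = flagMem2 d (2 * m - 1) →
      v c = v d := by
    intro c d h
    refine apply_eq_of_panel v (k := 2 * m - 1) (by omega)
      (fun i _ c d => apply_eq_of_panel_of_mulVec_eq (hv i (by omega))) c d
      fun j hj => ?_
    rcases hj.eq_or_lt with rfl | hj'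
    · exact h
    · rw [flagMem2_eq_top c (by omega), flagMem2_eq_top d (by omega)]
  let N : MaxFlag2 F m → ℂ := fun d =>
    ∑ c : MaxFlag2 F m, if flagMem2 c (2 * m - 1) = flagMem2 d (2 * m - 1) then (1 : ℂ) else 0
  have hN : ∀ d, N d ≠ 0 := by
    intro d
    simp only [N, Finset.sum_boole]
    rw [Nat.cast_ne_zero]
    exact Finset.card_ne_zero_of_mem (a := d) (by simp)
  have heq : v = ∑ c : MaxFlag2 F m, ((N c)⁻¹ * v c) • fun d =>
      if flagMem2 c (2 * m - 1) = flagMem2 d (2 * m - 1) then (1 : ℂ) else 0 := by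
    funext d
    rw [Finset.sum_apply]
    have h2 : ∀ c, (((N c)⁻¹ * v c) • fun d =>
        if flagMem2 c (2 * m - 1) = flagMem2 d (2 * m - 1) then (1 : ℂ) else 0) d =
        ((N d)⁻¹ * v d) *
          if flagMem2 c (2 * m - 1) = flagMem2 d (2 * m - 1) then (1 : ℂ) else 0 := by
      intro c
      rw [Pi.smul_apply, smul_eq_mul]
      split_ifs with h
      · rw [h1 c d h]
        simp only [N, h]
      · simp
    rw [Finset.sum_congr rfl fun c _ => h2 c, ← Finset.mul_sum]
    change v d = (N d)⁻¹ * v d * N d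
    field_simp [hN d]
  rw [heq]
  exact Submodule.sum_mem _ fun c _ =>
    Submodule.smul_mem _ _ (hyperplane_indicator_mem_memSpan hm c)

end Hyperplane

end MaxFlag2

theorem HeckeRel.map {R S : Type*} [Ring R] [Algebra ℂ R] [Ring S] [Algebra ℂ S] {q r : ℕ}
    {T : ℕ → R} (h : HeckeRel q r T) (f : R →ₐ[ℂ] S) : HeckeRel q r fun i => f (T i) where
  quad i hi := by rw [← map_mul, h.quad i hi]; simp
  braid i hi := by simp only [← map_mul, h.braid i hi]
  comm i j hij hj := (h.comm i j hij hj).map f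

theorem map_jucysMurphyProd {R S : Type*} [Monoid R] [Monoid S] (f : R →* S) (T : ℕ → R) (k : ℕ) :
    f (jucysMurphyProd T k) = jucysMurphyProd (fun i => f (T i)) k := by
  have h : ∀ k, f (jucysMurphy T k) = jucysMurphy (fun i => f (T i)) k := by
    intro k
    induction k with
    | zero => exact map_one f
    | succ k ih => simp only [jucysMurphy, map_mul, ih]
  induction k with
  | zero => exact map_one f
  | succ k ih => simp only [jucysMurphyProd, map_mul, ih, h]

namespace MaxFlag2

section Span

variable {F : Type} [Field F] [Fintype F] {m : ℕ}

theorem mem_memSpan_of_adj2 (hm : 1 ≤ m) {v : MaxFlag2 F m → ℂ}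
    (hv : adj2 F m *ᵥ v = (-((Fintype.card F : ℂ) ^ (2 * m ^ 2 - 2 * m))) • v) :
    v ∈ memSpan F m := by
  classical
  let φ : Matrix (MaxFlag2 F m) (MaxFlag2 F m) ℂ ≃ₐ[ℂ]
    Module.End ℂ (EuclideanSpace ℂ (MaxFlag2 F m)) := Matrix.toLpLinAlgEquiv 2
  have hφ : ∀ A w, φ A w = WithLp.toLp 2 (A *ᵥ w.ofLp) := fun A w => Matrix.toLpLin_apply 2 2 A w
  have hT := (heckeRel_adjacentMatrix (F := F) (m := m)).map φ.toAlgHom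
  let W : Submodule ℂ (EuclideanSpace ℂ (MaxFlag2 F m)) :=
    (memSpan F m).comap (WithLp.linearEquiv 2 ℂ (MaxFlag2 F m → ℂ)).toLinearMap
  have hW : ∀ w, w ∈ W ↔ w.ofLp ∈ memSpan F m := fun w => Iff.rfl
  have hmem : WithLp.toLp 2 v ∈ W := by
    refine hT.mem_of_jucysMurphyProd_apply_eq (p := 2 * m - 2)
      (N := (2 * m ^ 2 - 2 * m) + (2 * m ^ 2 - 2 * m)) Fintype.one_lt_card
      (fun i hi => ?_) (by omega) ?_ W (fun i hi w hw => ?_) (fun w hw => ?_) ?_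
    · refine Matrix.isSymmetric_toEuclideanLin_iff.mpr (Matrix.IsHermitian.ext fun c d => ?_)
      have h1 := congrFun (congrFun (transpose_adjacentMatrix (F := F) (m := m) i) c) d
      rw [← h1]
      simp only [Matrix.transpose_apply, adjacentMatrix, relMatrix]
      split_ifs <;> simp
    · obtain ⟨k, rfl⟩ := Nat.exists_eq_add_of_le' hm
      rw [show 2 * (k + 1) ^ 2 = 2 * (k + 1) + 2 * k * (k + 1) by ring, Nat.add_sub_cancel_left,
        show 2 * (k + 1) - 1 = 2 * k + 1 by omega]
      ring
    · exact adjacentMatrix_mulVec_mem_memSpan (by omega) hw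
    · exact mem_memSpan_of_trivial hm fun i hi => congrArg WithLp.ofLp (hw i hi)
    · have h1 := map_jucysMurphyProd (MonoidHomClass.toMonoidHom φ) (adjacentMatrix F m) (2 * m - 1)
      rw [← adj2_mul_self hm] at h1
      refine (congrArg (fun f => f (WithLp.toLp 2 v)) h1.symm).trans ?_
      change φ _ _ = _
      rw [hφ, ← Matrix.mulVec_mulVec, hv, Matrix.mulVec_smul, hv, smul_smul, neg_mul_neg,
        ← pow_add, WithLp.toLp_smul]
  exact hmem

/-- The span of the functions `chi2`. -/
def chiSpan (F : Type) [Field F] [Fintype F] (m : ℕ) : Submodule ℂ (MaxFlag2 F m → ℂ) :=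
  Submodule.span ℂ
    {f : MaxFlag2 F m → ℂ | ∃ (j : ℕ) (P : Submodule F (Fin (2 * m) → F)),
      1 ≤ j ∧ j ≤ m ∧ Module.finrank F P = 1 ∧ f = chi2 F m j P}

theorem chiSpan_le_eigenspace (hm : 1 ≤ m) :
    chiSpan F m ≤ Module.End.eigenspace (adj2 F m).mulVecLin
      (-((Fintype.card F : ℂ) ^ (2 * m ^ 2 - 2 * m))) := by
  refine Submodule.span_le.mpr ?_
  rintro _ ⟨j, P, _, hj, hP, rfl⟩
  exact Module.End.mem_eigenspace_iff.mpr (adj2_mulVec_chi2 hm hj hP)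

theorem memVec_add_mem {x : Fin (2 * m) → F} (hx : x ≠ 0) (hm : 1 ≤ m) {i : ℕ} (hi : i ≤ m) :
    memVec x (m + i) + (Fintype.card F : ℂ) ^ i • memVec x (m - i) ∈
      chiSpan F m ⊔ Submodule.span ℂ {1} := by
  set U := chiSpan F m ⊔ Submodule.span ℂ {(1 : MaxFlag2 F m → ℂ)}
  have hone : (1 : MaxFlag2 F m → ℂ) ∈ U :=
    Submodule.mem_sup_right (Submodule.mem_span_singleton_self _)
  have hchi : ∀ j, 1 ≤ j → j ≤ m → ((Fintype.card F : ℂ) ^ j + 1) • memVec x m -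
      (Fintype.card F : ℂ) ^ j • memVec x (m - j) - memVec x (m + j) ∈ U := by
    intro j hj hjm
    rw [← chi2_span_singleton]
    exact Submodule.mem_sup_left (Submodule.subset_span
      ⟨j, _, hj, hjm, finrank_span_singleton hx, rfl⟩)
  have hpos : (Fintype.card F : ℂ) ^ m + 1 ≠ 0 := by
    exact_mod_cast Nat.succ_ne_zero (Fintype.card F ^ m)
  have hmid : memVec x m ∈ U := by
    have h1 := hchi m hm le_rfl
    rw [Nat.sub_self, memVec_zero hx, smul_zero, sub_zero,
      memVec_of_le (by omega : 2 * m ≤ m + m)] at h1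
    rw [← Submodule.smul_mem_iff U hpos]
    simpa using U.add_mem h1 hone
  rcases Nat.eq_zero_or_pos i with rfl | hi0
  · simpa using U.add_mem hmid hmid
  · have h1 := U.sub_mem (U.smul_mem ((Fintype.card F : ℂ) ^ i + 1) hmid) (hchi i hi0 hi)
    convert h1 using 1
    module

theorem sub_adj2_mulVec_mem (hm : 1 ≤ m) {v : MaxFlag2 F m → ℂ} (hv : v ∈ memSpan F m) :
    (Fintype.card F : ℂ) ^ (2 * m ^ 2 - 2 * m) • v - adj2 F m *ᵥ v ∈
      chiSpan F m ⊔ Submodule.span ℂ {1} := by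
  set U := chiSpan F m ⊔ Submodule.span ℂ {(1 : MaxFlag2 F m → ℂ)} with hU
  have hone : (1 : MaxFlag2 F m → ℂ) ∈ U :=
    Submodule.mem_sup_right (Submodule.mem_span_singleton_self _)
  have hq : (Fintype.card F : ℂ) ≠ 0 := Nat.cast_ne_zero.mpr Fintype.card_ne_zero
  have key : memSpan F m ≤ U.comap
      ((Fintype.card F : ℂ) ^ (2 * m ^ 2 - 2 * m) • LinearMap.id - (adj2 F m).mulVecLin) := by
    refine Submodule.span_le.mpr ?_
    rintro _ ⟨x, k, hx, hk, rfl⟩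
    change (Fintype.card F : ℂ) ^ (2 * m ^ 2 - 2 * m) • memVec x k - adj2 F m *ᵥ memVec x k ∈ U
    rcases le_total m k with hmk | hkm
    · obtain ⟨i, rfl⟩ := Nat.exists_eq_add_of_le hmk
      have h1 := U.sub_mem (memVec_add_mem hx hm (by omega : i ≤ m))
        (U.smul_mem ((Fintype.card F : ℂ) ^ i) hone)
      rw [adj2_mulVec_memVec_add hx hm (by omega)]
      convert U.smul_mem ((Fintype.card F : ℂ) ^ (2 * m ^ 2 - 2 * m)) h1 using 1
      module
    · obtain ⟨i, hi, rfl⟩ : ∃ i ≤ m, k = m - i := ⟨m - k, by omega, by omega⟩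
      have h1 := U.sub_mem (memVec_add_mem hx hm hi) hone
      rw [← Submodule.smul_mem_iff U (pow_ne_zero i hq), smul_sub,
        adj2_mulVec_memVec_sub hx hm hi]
      convert U.smul_mem ((Fintype.card F : ℂ) ^ (2 * m ^ 2 - 2 * m)) h1 using 1
      module
  exact key hv

theorem adj2_mulVec_one (hm : 1 ≤ m) :
    adj2 F m *ᵥ 1 =
      ((Fintype.card F : ℂ) ^ (2 * m ^ 2 - 2 * m) * (Fintype.card F : ℂ) ^ m) • 1 := by
  have : Nonempty (Fin (2 * m)) := ⟨⟨0, by omega⟩⟩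
  obtain ⟨x, hx⟩ := exists_ne (0 : Fin (2 * m) → F)
  have h := adj2_mulVec_memVec_add hx hm le_rfl
  rwa [Nat.sub_self, memVec_zero hx, sub_zero, memVec_of_le (by omega : 2 * m ≤ m + m)] at h

theorem eigenspace_le_chiSpan (hm : 1 ≤ m) :
    Module.End.eigenspace (adj2 F m).mulVecLin
      (-((Fintype.card F : ℂ) ^ (2 * m ^ 2 - 2 * m))) ≤ chiSpan F m := by
  intro f hf
  set θ := (Fintype.card F : ℂ) ^ (2 * m ^ 2 - 2 * m) with hθ
  have hθ0 : θ ≠ 0 := pow_ne_zero _ (Nat.cast_ne_zero.mpr Fintype.card_ne_zero)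
  have hpos : (Fintype.card F : ℂ) ^ m + 1 ≠ 0 := by
    exact_mod_cast Nat.succ_ne_zero (Fintype.card F ^ m)
  have hA : adj2 F m *ᵥ f = (-θ) • f := Module.End.mem_eigenspace_iff.mp hf
  have h1 := sub_adj2_mulVec_mem hm (mem_memSpan_of_adj2 hm hA)
  rw [← hθ, hA, ← sub_smul, Submodule.smul_mem_iff _
    (by rw [sub_neg_eq_add, ← two_mul]; exact mul_ne_zero two_ne_zero hθ0)] at h1
  obtain ⟨s, hs, t, ht, hst⟩ := Submodule.mem_sup.mp h1
  obtain ⟨c, rfl⟩ := Submodule.mem_span_singleton.mp ht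
  have hAs : adj2 F m *ᵥ s = (-θ) • s :=
    Module.End.mem_eigenspace_iff.mp (chiSpan_le_eigenspace hm hs)
  rw [← hst, Matrix.mulVec_add, Matrix.mulVec_smul, hAs, adj2_mulVec_one hm, ← hθ, smul_add,
    add_right_inj] at hA
  have h2 : (θ * ((Fintype.card F : ℂ) ^ m + 1)) • c • (1 : MaxFlag2 F m → ℂ) = 0 := by
    rw [← sub_eq_zero] at hA
    rw [← hA]
    module
  rw [← hst, (smul_eq_zero.mp h2).resolve_left (mul_ne_zero hθ0 hpos), add_zero]
  exact hs

end Span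

end MaxFlag2

/-- Each `χ_j^P` is an eigenfunction of the opposition graph with eigenvalue
`-q^(2m²-2m)`, and together they span the full eigenspace of this eigenvalue. -/
theorem chi_span_eigenspace (F : Type) [Field F] [Fintype F] (q : ℕ)
    (hq : Fintype.card F = q) (m : ℕ) (hm : 1 ≤ m) :
    (∀ (j : ℕ) (P : Submodule F (Fin (2 * m) → F)), 1 ≤ j → j ≤ m →
      Module.finrank F P = 1 →
      (adj2 F m).mulVecLin (chi2 F m j P) =
        (-((q : ℂ) ^ (2 * m ^ 2 - 2 * m))) • chi2 F m j P) ∧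
    Submodule.span ℂ
        {f : MaxFlag2 F m → ℂ | ∃ (j : ℕ) (P : Submodule F (Fin (2 * m) → F)),
          1 ≤ j ∧ j ≤ m ∧ Module.finrank F P = 1 ∧ f = chi2 F m j P} =
      Module.End.eigenspace (adj2 F m).mulVecLin (-((q : ℂ) ^ (2 * m ^ 2 - 2 * m))) := by
  subst hq
  refine ⟨fun j P _ hj hP => MaxFlag2.adj2_mulVec_chi2 hm hj hP, ?_⟩
  exact le_antisymm (MaxFlag2.chiSpan_le_eigenspace hm) (MaxFlag2.eigenspace_le_chiSpan hm)
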